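/- arXiv:1008.0249 — 11 statements merged into one kernel-verified Lean document; each statement's English description precedes it below -/
import Mathlib

section
/- Let g : ℝ → ℝ be an even, unimodal probability density (so g(ω₁) > g(ω₂) whenever 0 ≤ ω₁ < ω₂), and set K_c := 2/(π·g(0)). Then for every K with 0 < K ≤ K_c there is no λ ∈ ℂ with Re λ > 0 satisfying D(λ) = ∫_ℝ g(ω)/(λ − iω) dω = 2/K. (For 0 < K ≤ K_c the linearized Kuramoto operator T₁ has no eigenvalues in the right half plane; the de-synchronous state is not linearly unstable.) -/
open MeasureTheory Filter

/-- The half-plane Poisson kernel as a rescaled and translated copy of `(1 + t ^ 2)⁻¹`. -/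
lemma poissonKernel_eq {x : ℝ} (hx : 0 < x) (y ω : ℝ) :
    x / (x ^ 2 + (ω - y) ^ 2) = x⁻¹ * (1 + ((ω - y) / x) ^ 2)⁻¹ := by
  have h : x ^ 2 + (ω - y) ^ 2 ≠ 0 := by positivity
  have h' : 1 + ((ω - y) / x) ^ 2 ≠ 0 := by positivity
  field_simp

lemma integrable_poissonKernel {x : ℝ} (hx : 0 < x) (y : ℝ) :
    Integrable fun ω : ℝ ↦ x / (x ^ 2 + (ω - y) ^ 2) := by
  simp_rw [poissonKernel_eq hx]
  exact ((integrable_inv_one_add_sq.comp_div hx.ne').comp_sub_right y).const_mul _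

lemma integral_poissonKernel {x : ℝ} (hx : 0 < x) (y : ℝ) :
    ∫ ω : ℝ, x / (x ^ 2 + (ω - y) ^ 2) = Real.pi := by
  simp_rw [poissonKernel_eq hx]
  rw [integral_const_mul, integral_sub_right_eq_self (fun t : ℝ ↦ (1 + (t / x) ^ 2)⁻¹) y,
    Measure.integral_comp_div (fun t : ℝ ↦ (1 + t ^ 2)⁻¹) x, integral_univ_inv_one_add_sq,
    abs_of_pos hx, smul_eq_mul, inv_mul_cancel_left₀ hx.ne']

lemma re_ofReal_div_sub_I_mul (a ω : ℝ) (z : ℂ) :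
    ((a : ℂ) / (z - Complex.I * ω)).re = a * (z.re / (z.re ^ 2 + (ω - z.im) ^ 2)) := by
  rw [Complex.div_re, Complex.normSq_apply]
  simp
  ring

/-- A function lying below `M` everywhere, strictly so on a half-line, has Poisson average
strictly below `M`. -/
lemma integral_mul_poissonKernel_lt {g : ℝ → ℝ} {M x y : ℝ} (hx : 0 < x)
    (hle : ∀ ω, g ω ≤ M) (hlt : ∀ ω, 0 < ω → g ω < M)
    (hint : Integrable fun ω : ℝ ↦ g ω * (x / (x ^ 2 + (ω - y) ^ 2))) :
    ∫ ω : ℝ, g ω * (x / (x ^ 2 + (ω - y) ^ 2)) < M * Real.pi := by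
  have hM := (integrable_poissonKernel hx y).const_mul M
  rw [← integral_poissonKernel hx y, ← integral_const_mul, ← sub_pos, ← integral_sub hM hint]
  have hker (ω : ℝ) : 0 < x / (x ^ 2 + (ω - y) ^ 2) := by positivity
  refine (integral_pos_iff_support_of_nonneg (fun ω ↦ ?_) (hM.sub hint)).2 ?_
  · exact sub_nonneg.2 (mul_le_mul_of_nonneg_right (hle ω) (hker ω).le)
  · refine lt_of_lt_of_le ?_ (measure_mono (s := Set.Ioi 0) fun ω hω ↦ ?_)
    · simp
    · exact (sub_pos.2 (mul_lt_mul_of_pos_right (hlt ω hω) (hker ω))).ne'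

/-- **Stability half of the Kuramoto transition (Theorem 3.5 / Corollary 3.6).**
Let `g` be an even, unimodal probability density and `K_c = 2/(π g 0)`.
For `0 < K ≤ K_c` there is no `λ` with `Re λ > 0` satisfying `D(λ) = 2/K`. -/
theorem kuramoto_no_eigenvalues_below_transition
    (g : ℝ → ℝ) (hmeas : Measurable g) (hnonneg : ∀ ω, 0 ≤ g ω)
    (hprob : ∫ ω : ℝ, g ω = 1)
    (heven : ∀ ω : ℝ, g (-ω) = g ω)
    (hunimodal : ∀ ω₁ ω₂ : ℝ, 0 ≤ ω₁ → ω₁ < ω₂ → g ω₂ < g ω₁)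
    (K : ℝ) (hK : 0 < K) (hKc : K ≤ 2 / (Real.pi * g 0)) :
    ¬ ∃ z : ℂ, 0 < z.re ∧
      (∫ ω : ℝ, (g ω : ℂ) / (z - Complex.I * ω)) = 2 / (K : ℂ) := by
  rintro ⟨z, hz, hD⟩
  have hlt : ∀ ω, 0 < ω → g ω < g 0 := fun ω ↦ hunimodal 0 ω le_rfl
  have hle (ω : ℝ) : g ω ≤ g 0 := by
    rcases lt_trichotomy ω 0 with h | rfl | h
    · exact heven ω ▸ (hlt (-ω) (neg_pos.2 h)).le
    · exact le_rfl
    · exact (hlt ω h).le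
  have hg0 : 0 < g 0 := (hnonneg 1).trans_lt (hlt 1 one_pos)
  have hint : Integrable fun ω : ℝ ↦ (g ω : ℂ) / (z - Complex.I * ω) := by
    by_contra h
    rw [integral_undef h] at hD
    exact div_ne_zero two_ne_zero (Complex.ofReal_ne_zero.2 hK.ne') hD.symm
  have hre : ∫ ω : ℝ, g ω * (z.re / (z.re ^ 2 + (ω - z.im) ^ 2)) = 2 / K := by
    simp_rw [← re_ofReal_div_sub_I_mul]
    have h := integral_re hint
    simp only [RCLike.re_to_complex] at h
    rw [h, hD]
    exact_mod_cast Complex.ofReal_re (2 / K)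
  have hintre := hint.re
  simp only [RCLike.re_to_complex, re_ofReal_div_sub_I_mul] at hintre
  have hupper := integral_mul_poissonKernel_lt hz hle hlt hintre
  rw [hre, div_lt_iff₀ hK] at hupper
  rw [le_div_iff₀ (by positivity)] at hKc
  linarith
end

section
/- Let g : ℝ → ℝ be an even, unimodal probability density that is continuous at 0, and set K_c := 2/(π·g(0)). Then for every K > K_c there exists a real number λ > 0 such that ∫_ℝ λ/(λ² + ω²) · g(ω) dω = 2/K and ∫_ℝ ω/(λ² + ω²) · g(ω) dω = 0; equivalently, D(λ) = ∫_ℝ g(ω)/(λ − iω) dω = 2/K. (For K > K_c the linearized Kuramoto operator T₁ has a real positive eigenvalue, so the de-synchronous state is linearly unstable.) -/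
open MeasureTheory Filter

theorem div_sq_add_sq_le_inv {l : ℝ} (hl : 0 < l) (ω : ℝ) :
    l / (l ^ 2 + ω ^ 2) ≤ l⁻¹ := by
  rw [inv_eq_one_div, div_le_div_iff₀ (by positivity) hl]
  nlinarith [sq_nonneg ω]

theorem abs_div_sq_add_sq_le_inv {l : ℝ} (hl : 0 < l) (ω : ℝ) :
    |ω / (l ^ 2 + ω ^ 2)| ≤ l⁻¹ := by
  rw [abs_div, abs_of_pos (by positivity : 0 < l ^ 2 + ω ^ 2), inv_eq_one_div,
    div_le_div_iff₀ (by positivity) hl, ← sq_abs ω]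
  nlinarith [sq_nonneg (l - |ω|), abs_nonneg ω]

theorem integrable_poissonKernel_mul {g : ℝ → ℝ} (hg : Integrable g) {l : ℝ} (hl : 0 < l) :
    Integrable fun ω : ℝ => l / (l ^ 2 + ω ^ 2) * g ω := by
  refine hg.bdd_mul (c := l⁻¹) (Measurable.aestronglyMeasurable (by fun_prop))
    (.of_forall fun ω => ?_)
  rw [Real.norm_of_nonneg (by positivity)]
  exact div_sq_add_sq_le_inv hl ω

theorem integrable_conjPoissonKernel_mul {g : ℝ → ℝ} (hg : Integrable g) {l : ℝ} (hl : 0 < l) :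
    Integrable fun ω : ℝ => ω / (l ^ 2 + ω ^ 2) * g ω :=
  hg.bdd_mul (c := l⁻¹) (Measurable.aestronglyMeasurable (by fun_prop))
    (.of_forall fun ω => abs_div_sq_add_sq_le_inv hl ω)

theorem integral_eq_zero_of_neg_eq_neg {f : ℝ → ℝ} (hf : ∀ ω, f (-ω) = -f ω) :
    ∫ ω, f ω = 0 := by
  have h := integral_neg_eq_self f volume
  simp only [hf, integral_neg] at h
  linarith

theorem continuousOn_integral_poissonKernel_mul {g : ℝ → ℝ} (hg : Integrable g)
    {a b : ℝ} (ha : 0 < a) :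
    ContinuousOn (fun l : ℝ => ∫ ω, l / (l ^ 2 + ω ^ 2) * g ω) (Set.Icc a b) := by
  refine continuousOn_of_dominated (bound := fun ω => a⁻¹ * ‖g ω‖)
    (fun l hl => (integrable_poissonKernel_mul hg (ha.trans_le hl.1)).aestronglyMeasurable)
    (fun l hl => .of_forall fun ω => ?_) (hg.norm.const_mul _) (.of_forall fun ω => ?_)
  · have hl0 : 0 < l := ha.trans_le hl.1
    rw [norm_mul, Real.norm_of_nonneg (by positivity : 0 ≤ l / (l ^ 2 + ω ^ 2))]
    gcongr
    exact (div_sq_add_sq_le_inv hl0 ω).trans (inv_anti₀ ha hl.1)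
  · refine ContinuousOn.mul (ContinuousOn.div (by fun_prop) (by fun_prop) fun l hl => ?_)
      continuousOn_const
    have hl0 : 0 < l := ha.trans_le hl.1
    positivity

theorem integral_poissonKernel_mul_le_inv {g : ℝ → ℝ} (hg : Integrable g) (hg0 : ∀ ω, 0 ≤ g ω)
    (hg1 : ∫ ω, g ω = 1) {l : ℝ} (hl : 0 < l) :
    ∫ ω, l / (l ^ 2 + ω ^ 2) * g ω ≤ l⁻¹ := by
  calc ∫ ω, l / (l ^ 2 + ω ^ 2) * g ω ≤ ∫ ω, l⁻¹ * g ω :=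
        integral_mono (integrable_poissonKernel_mul hg hl) (hg.const_mul _) fun ω =>
          mul_le_mul_of_nonneg_right (div_sq_add_sq_le_inv hl ω) (hg0 ω)
    _ = l⁻¹ := by rw [integral_const_mul, hg1, mul_one]

theorem integral_poissonKernel_mul_eq_rescaled (g : ℝ → ℝ) {l : ℝ} (hl : 0 < l) :
    ∫ ω, l / (l ^ 2 + ω ^ 2) * g ω = ∫ x, (1 + x ^ 2)⁻¹ * g (l * x) := by
  have h := Measure.integral_comp_mul_left (fun ω => l / (l ^ 2 + ω ^ 2) * g ω) l
  rw [abs_of_pos (inv_pos.2 hl), smul_eq_mul, inv_mul_eq_div, eq_div_iff hl.ne'] at h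
  rw [← h, ← integral_mul_const]
  congr 1 with x
  have : 1 + x ^ 2 ≠ 0 := by positivity
  field_simp

theorem tendsto_integral_poissonKernel_mul {g : ℝ → ℝ} (hmeas : Measurable g) {C : ℝ}
    (hC : ∀ ω, ‖g ω‖ ≤ C) (hcont : ContinuousAt g 0) :
    Tendsto (fun l : ℝ => ∫ ω, l / (l ^ 2 + ω ^ 2) * g ω) (nhdsWithin 0 (Set.Ioi 0))
      (nhds (Real.pi * g 0)) := by
  have key : Tendsto (fun l : ℝ => ∫ x, (1 + x ^ 2)⁻¹ * g (l * x)) (nhdsWithin 0 (Set.Ioi 0))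
      (nhds (∫ x : ℝ, (1 + x ^ 2)⁻¹ * g 0)) := by
    refine tendsto_integral_filter_of_dominated_convergence (fun x => (1 + x ^ 2)⁻¹ * C)
      (.of_forall fun l => Measurable.aestronglyMeasurable (by fun_prop))
      (.of_forall fun l => .of_forall fun x => ?_) (integrable_inv_one_add_sq.mul_const C)
      (.of_forall fun x => ?_)
    · rw [norm_mul, Real.norm_of_nonneg (by positivity : 0 ≤ (1 + x ^ 2)⁻¹)]
      gcongr
      exact hC _
    · refine Tendsto.const_mul _ (hcont.tendsto.comp ?_)
      have h : Continuous fun l : ℝ => l * x := by fun_prop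
      simpa using (h.tendsto 0).mono_left nhdsWithin_le_nhds
  rw [integral_mul_const, integral_univ_inv_one_add_sq] at key
  refine key.congr' ?_
  filter_upwards [self_mem_nhdsWithin] with l hl
  exact (integral_poissonKernel_mul_eq_rescaled g hl).symm

theorem integral_ofReal_div_sub_I_mul {g : ℝ → ℝ} (hg : Integrable g) {l : ℝ} (hl : 0 < l) :
    ∫ ω : ℝ, (g ω : ℂ) / ((l : ℂ) - Complex.I * ω) =
      ((∫ ω, l / (l ^ 2 + ω ^ 2) * g ω : ℝ) : ℂ) +
        ((∫ ω, ω / (l ^ 2 + ω ^ 2) * g ω : ℝ) : ℂ) * Complex.I := by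
  rw [← integral_complex_ofReal, ← integral_complex_ofReal, ← integral_mul_const,
    ← integral_add (integrable_poissonKernel_mul hg hl).ofReal
      ((integrable_conjPoissonKernel_mul hg hl).ofReal.mul_const _)]
  congr 1 with ω
  have h1 : (l : ℂ) - Complex.I * ω ≠ 0 := fun h => hl.ne' (by simpa using congrArg Complex.re h)
  have h2 : (l : ℂ) ^ 2 + (ω : ℂ) ^ 2 ≠ 0 := by
    exact_mod_cast (by positivity : l ^ 2 + ω ^ 2 ≠ 0)
  push_cast
  field_simp
  linear_combination ((g ω : ℂ) * ω ^ 2) * Complex.I_sq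

/-- **Instability half of the Kuramoto transition (Theorem 3.5 / Corollary 3.6).**
Let `g` be an even, unimodal probability density continuous at `0`, and
`K_c = 2/(π g 0)`. For every `K > K_c` there is a real `λ > 0` with
`∫ λ/(λ² + ω²) g(ω) dω = 2/K` and `∫ ω/(λ² + ω²) g(ω) dω = 0`; equivalently
`D(λ) = ∫ g(ω)/(λ − iω) dω = 2/K`. -/
theorem kuramoto_instability_above_transition
    (g : ℝ → ℝ) (hmeas : Measurable g) (hnonneg : ∀ ω, 0 ≤ g ω)
    (hprob : ∫ ω : ℝ, g ω = 1)
    (heven : ∀ ω : ℝ, g (-ω) = g ω)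
    (hunimodal : ∀ ω₁ ω₂ : ℝ, 0 ≤ ω₁ → ω₁ < ω₂ → g ω₂ < g ω₁)
    (hcont : ContinuousAt g 0)
    (K : ℝ) (hK : 2 / (Real.pi * g 0) < K) :
    ∃ l : ℝ, 0 < l ∧
      (∫ ω : ℝ, l / (l ^ 2 + ω ^ 2) * g ω) = 2 / K ∧
      (∫ ω : ℝ, ω / (l ^ 2 + ω ^ 2) * g ω) = 0 ∧
      (∫ ω : ℝ, (g ω : ℂ) / ((l : ℂ) - Complex.I * ω)) = 2 / (K : ℂ) := by
  have hg : Integrable g := .of_integral_ne_zero (by simp [hprob])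
  have hg0 : 0 < g 0 := (hnonneg 1).trans_lt (hunimodal 0 1 le_rfl one_pos)
  have hpos : ∀ ω, 0 ≤ ω → g ω ≤ g 0 := fun ω hω =>
    hω.eq_or_lt.elim (fun h => h ▸ le_rfl) fun h => (hunimodal 0 ω le_rfl h).le
  have hbound : ∀ ω, ‖g ω‖ ≤ g 0 := fun ω => by
    rw [Real.norm_of_nonneg (hnonneg ω)]
    rcases le_total 0 ω with h | h
    · exact hpos ω h
    · exact heven ω ▸ hpos (-ω) (neg_nonneg.2 h)
  have hK0 : 0 < K := lt_trans (by positivity) hK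
  have hlt : 2 / K < Real.pi * g 0 := by
    rw [div_lt_iff₀ (by positivity)] at hK ⊢
    linarith
  obtain ⟨a, haK, haF⟩ := (Eventually.and (Ioo_mem_nhdsGT hK0)
    ((tendsto_integral_poissonKernel_mul hmeas hbound hcont).eventually_const_lt hlt)).exists
  have hKF : ∫ ω, K / (K ^ 2 + ω ^ 2) * g ω ≤ 2 / K :=
    (integral_poissonKernel_mul_le_inv hg hnonneg hprob hK0).trans
      (by rw [inv_eq_one_div]; gcongr; norm_num)
  obtain ⟨l, hl, hlF⟩ := intermediate_value_Icc' haK.2.le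
    (continuousOn_integral_poissonKernel_mul hg haK.1) ⟨hKF, haF.le⟩
  have hl0 : 0 < l := haK.1.trans_le hl.1
  have hodd : ∫ ω, ω / (l ^ 2 + ω ^ 2) * g ω = 0 :=
    integral_eq_zero_of_neg_eq_neg fun ω => by rw [heven, neg_sq, neg_div, neg_mul]
  refine ⟨l, hl0, hlF, hodd, ?_⟩
  rw [integral_ofReal_div_sub_I_mul hg hl0, hodd]
  simp only at hlF
  rw [hlF]
  simp
end

section
/- Let g be a probability density. Then there exists K₀ > 0 such that for every K ≥ K₀ there exists λ ∈ ℂ with Re λ > 0 and D(λ) = ∫_ℝ g(ω)/(λ − iω) dω = 2/K. (If the coupling strength K is sufficiently large, the equation D(λ) = 2/K has at least one root, which lies near λ = K/2.) -/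
open MeasureTheory Filter

/-- On the disk of radius `K / 4` about `K / 2` the distance to the imaginary axis is at
least `K / 4`. -/
lemma quarter_le_norm_sub_I_mul {K : ℝ} {z : ℂ} (hz : ‖z - (K / 2 : ℝ)‖ ≤ K / 4) (ω : ℝ) :
    K / 4 ≤ ‖z - Complex.I * ω‖ := by
  have h1 := (Complex.abs_re_le_norm (z - (K / 2 : ℝ))).trans hz
  have h2 := Complex.re_le_norm (z - Complex.I * ω)
  rw [Complex.sub_re, Complex.ofReal_re, abs_le] at h1
  simp only [Complex.sub_re, Complex.mul_re, Complex.I_re, Complex.I_im, Complex.ofReal_re,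
    Complex.ofReal_im] at h2
  linarith

lemma abs_le_min_mul_norm_sub_I_mul {K : ℝ} (hK : 0 < K) {z : ℂ}
    (hz : ‖z - (K / 2 : ℝ)‖ ≤ K / 4) (ω : ℝ) :
    |ω| ≤ 4 * min 1 (|ω| / K) * ‖z - Complex.I * ω‖ := by
  have h1 := quarter_le_norm_sub_I_mul hz ω
  have h2 : ‖z‖ ≤ 3 * (K / 4) := by
    have h := norm_add_le (z - (K / 2 : ℝ)) ((K / 2 : ℝ) : ℂ)
    rw [sub_add_cancel, Complex.norm_real, Real.norm_of_nonneg (by positivity)] at h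
    linarith
  have h3 : |ω| ≤ ‖z‖ + ‖z - Complex.I * ω‖ := by
    have h := norm_sub_le z (z - Complex.I * ω)
    rwa [sub_sub_cancel, norm_mul, Complex.norm_I, one_mul, Complex.norm_real,
      Real.norm_eq_abs] at h
  rcases min_choice 1 (|ω| / K) with h | h <;> rw [h]
  · linarith
  · calc |ω| = 4 * (|ω| / K) * (K / 4) := by field_simp
      _ ≤ _ := by gcongr

lemma integrable_mul_min {g : ℝ → ℝ} (hg : Integrable g) {K : ℝ} (hK : 0 < K) :
    Integrable fun ω ↦ g ω * min 1 (|ω| / K) := by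
  refine hg.mono (hg.aestronglyMeasurable.mul (by fun_prop)) (ae_of_all _ fun ω ↦ ?_)
  rw [norm_mul]
  refine mul_le_of_le_one_right (norm_nonneg _) ?_
  rw [Real.norm_of_nonneg (by positivity)]
  exact min_le_left _ _

lemma tendsto_integral_mul_min {g : ℝ → ℝ} (hg : Integrable g) :
    Tendsto (fun K : ℝ ↦ ∫ ω, g ω * min 1 (|ω| / K)) atTop (nhds 0) := by
  rw [show (0 : ℝ) = ∫ ω : ℝ, (0 : ℝ) by simp]
  refine tendsto_integral_filter_of_dominated_convergence (fun ω ↦ ‖g ω‖) ?_ ?_ hg.norm ?_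
  · filter_upwards [eventually_gt_atTop 0] with K hK
    exact (integrable_mul_min hg hK).aestronglyMeasurable
  · filter_upwards [eventually_gt_atTop 0] with K hK
    refine ae_of_all _ fun ω ↦ ?_
    rw [norm_mul]
    refine mul_le_of_le_one_right (norm_nonneg _) ?_
    rw [Real.norm_of_nonneg (by positivity)]
    exact min_le_left _ _
  · refine ae_of_all _ fun ω ↦ ?_
    have h : Tendsto (fun K : ℝ ↦ |ω| / K) atTop (nhds 0) := tendsto_const_nhds.div_atTop tendsto_id
    simpa using (tendsto_const_nhds (x := (1 : ℝ))).min h |>.const_mul (g ω)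

section Resolvent

variable {g : ℝ → ℝ} {K : ℝ} {z w : ℂ}

lemma integrable_div_sub_I_mul (hg : Integrable g) (hK : 0 < K)
    (hz : ‖z - (K / 2 : ℝ)‖ ≤ K / 4) :
    Integrable fun ω : ℝ ↦ (g ω : ℂ) / (z - Complex.I * ω) := by
  have hm : Measurable fun ω : ℝ ↦ (z - Complex.I * ω)⁻¹ := by fun_prop
  simp_rw [div_eq_mul_inv]
  refine hg.ofReal.mul_bdd (c := (K / 4)⁻¹) hm.aestronglyMeasurable (ae_of_all _ fun ω ↦ ?_)
  rw [norm_inv]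
  exact inv_anti₀ (by positivity) (quarter_le_norm_sub_I_mul hz ω)

lemma norm_mul_integral_sub_one_le (hg : Integrable g) (hnonneg : ∀ ω, 0 ≤ g ω)
    (hprob : ∫ ω : ℝ, g ω = 1) (hK : 0 < K) (hz : ‖z - (K / 2 : ℝ)‖ ≤ K / 4) :
    ‖z * (∫ ω : ℝ, (g ω : ℂ) / (z - Complex.I * ω)) - 1‖ ≤
      4 * ∫ ω, g ω * min 1 (|ω| / K) := by
  have h1 : (1 : ℂ) = ∫ ω : ℝ, (g ω : ℂ) := by rw [integral_complex_ofReal, hprob]; simp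
  have hgc : Integrable fun ω : ℝ ↦ (g ω : ℂ) := hg.ofReal
  rw [h1, ← integral_const_mul, ← integral_sub
    ((integrable_div_sub_I_mul hg hK hz).const_mul z) hgc, ← integral_const_mul]
  refine norm_integral_le_of_norm_le ((integrable_mul_min hg hK).const_mul 4)
    (ae_of_all _ fun ω ↦ ?_)
  have hpos : 0 < ‖z - Complex.I * ω‖ :=
    (by positivity : 0 < K / 4).trans_le (quarter_le_norm_sub_I_mul hz ω)
  have hne : z - Complex.I * ω ≠ 0 := norm_pos_iff.mp hpos
  have e : z * ((g ω : ℂ) / (z - Complex.I * ω)) - g ω =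
      g ω * (Complex.I * ω / (z - Complex.I * ω)) := by
    field_simp
    ring
  rw [e, norm_mul, Complex.norm_real, Real.norm_of_nonneg (hnonneg ω), mul_left_comm]
  refine mul_le_mul_of_nonneg_left ?_ (hnonneg ω)
  rw [norm_div, div_le_iff₀ hpos]
  simpa using abs_le_min_mul_norm_sub_I_mul hK hz ω

lemma norm_mul_integral_sub_mul_integral_le (hg : Integrable g) (hnonneg : ∀ ω, 0 ≤ g ω)
    (hK : 0 < K) (hz : ‖z - (K / 2 : ℝ)‖ ≤ K / 4) (hw : ‖w - (K / 2 : ℝ)‖ ≤ K / 4) :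
    ‖z * (∫ ω : ℝ, (g ω : ℂ) / (z - Complex.I * ω)) -
        w * (∫ ω : ℝ, (g ω : ℂ) / (w - Complex.I * ω))‖ ≤
      (16 / K * ‖z - w‖) * ∫ ω, g ω * min 1 (|ω| / K) := by
  rw [← integral_const_mul, ← integral_const_mul, ← integral_sub
    ((integrable_div_sub_I_mul hg hK hz).const_mul z)
    ((integrable_div_sub_I_mul hg hK hw).const_mul w), ← integral_const_mul]
  refine norm_integral_le_of_norm_le ((integrable_mul_min hg hK).const_mul _)
    (ae_of_all _ fun ω ↦ ?_)
  have hw4 := quarter_le_norm_sub_I_mul hw ω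
  have hpz : 0 < ‖z - Complex.I * ω‖ :=
    (by positivity : 0 < K / 4).trans_le (quarter_le_norm_sub_I_mul hz ω)
  have hpw : 0 < ‖w - Complex.I * ω‖ := (by positivity : 0 < K / 4).trans_le hw4
  have hnz : z - Complex.I * ω ≠ 0 := norm_pos_iff.mp hpz
  have hnw : w - Complex.I * ω ≠ 0 := norm_pos_iff.mp hpw
  have e : z * ((g ω : ℂ) / (z - Complex.I * ω)) - w * ((g ω : ℂ) / (w - Complex.I * ω)) =
      g ω * (-(Complex.I * ω * (z - w)) / ((z - Complex.I * ω) * (w - Complex.I * ω))) := by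
    field_simp
    ring
  rw [e, norm_mul, Complex.norm_real, Real.norm_of_nonneg (hnonneg ω), mul_left_comm]
  refine mul_le_mul_of_nonneg_left ?_ (hnonneg ω)
  rw [norm_div, norm_mul (z - Complex.I * ω), div_le_iff₀ (by positivity)]
  calc ‖-(Complex.I * ω * (z - w))‖ = |ω| * ‖z - w‖ := by simp
    _ ≤ 4 * min 1 (|ω| / K) * ‖z - Complex.I * ω‖ * ‖z - w‖ := by
      gcongr
      exact abs_le_min_mul_norm_sub_I_mul hK hz ω
    _ = 16 / K * ‖z - w‖ * min 1 (|ω| / K) * (‖z - Complex.I * ω‖ * (K / 4)) := by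
      field_simp
      ring
    _ ≤ _ := by gcongr

end Resolvent

/-- **Lemma 3.3(ii).** If the coupling strength `K` is sufficiently large, the
equation `D(λ) = ∫ g(ω)/(λ − iω) dω = 2/K` has at least one root in the right
half plane. -/
theorem eigenvalue_exists_for_large_coupling
    (g : ℝ → ℝ) (hmeas : Measurable g) (hnonneg : ∀ ω, 0 ≤ g ω)
    (hprob : ∫ ω : ℝ, g ω = 1) :
    ∃ K₀ : ℝ, 0 < K₀ ∧ ∀ K : ℝ, K₀ ≤ K →
      ∃ z : ℂ, 0 < z.re ∧
        (∫ ω : ℝ, (g ω : ℂ) / (z - Complex.I * ω)) = 2 / (K : ℂ) := by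
  have hg : Integrable g := by
    by_contra h
    simp [integral_undef h] at hprob
  obtain ⟨K₁, hK₁⟩ := eventually_atTop.mp
    ((tendsto_integral_mul_min hg).eventually_le_const (by norm_num : (0 : ℝ) < 1 / 16))
  refine ⟨max K₁ 1, by positivity, fun K hK ↦ ?_⟩
  have hKpos : 0 < K := one_pos.trans_le ((le_max_right _ _).trans hK)
  have hm := hK₁ K ((le_max_left _ _).trans hK)
  -- A root is a fixed point of `T z = (K / 2) z D(z)`, a contraction of the disk `S`.
  let T : ℂ → ℂ := fun z ↦ (K / 2 : ℝ) * (z * ∫ ω : ℝ, (g ω : ℂ) / (z - Complex.I * ω))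
  let S : Set ℂ := Metric.closedBall ((K / 2 : ℝ) : ℂ) (K / 4)
  have hS {z : ℂ} (hz : z ∈ S) : ‖z - (K / 2 : ℝ)‖ ≤ K / 4 := mem_closedBall_iff_norm.mp hz
  have hKnorm : ‖((K / 2 : ℝ) : ℂ)‖ = K / 2 := by
    rw [Complex.norm_real, Real.norm_of_nonneg (by positivity)]
  have hmaps : Set.MapsTo T S S := fun z hz ↦ by
    refine mem_closedBall_iff_norm.mpr ?_
    have h := norm_mul_integral_sub_one_le hg hnonneg hprob hKpos (hS hz)
    rw [← mul_sub_one, norm_mul, hKnorm]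
    calc _ ≤ K / 2 * (1 / 2) := by gcongr; linarith
      _ = K / 4 := by ring
  have hlip : ContractingWith (1 / 2) (hmaps.restrict T S S) := by
    refine ⟨by norm_num, LipschitzWith.of_dist_le_mul fun z w ↦ ?_⟩
    have h := norm_mul_integral_sub_mul_integral_le hg hnonneg hKpos (hS z.2) (hS w.2)
    rw [Subtype.dist_eq, Subtype.dist_eq, dist_eq_norm, dist_eq_norm, Set.MapsTo.val_restrict_apply,
      Set.MapsTo.val_restrict_apply, ← mul_sub, norm_mul, hKnorm]
    calc _ ≤ K / 2 * (16 / K * ‖(z : ℂ) - w‖ * (1 / 16)) := by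
          gcongr
          exact h.trans (by gcongr)
      _ = _ := by
          push_cast
          field_simp
  obtain ⟨z, hz, hfix, -⟩ := hlip.exists_fixedPoint' Metric.isClosed_closedBall.isComplete hmaps
    (Metric.mem_closedBall_self (by positivity)) (edist_ne_top _ _)
  have hre : 0 < z.re := by
    have h := (Complex.abs_re_le_norm (z - (K / 2 : ℝ))).trans (hS hz)
    rw [Complex.sub_re, Complex.ofReal_re, abs_le] at h
    linarith
  refine ⟨z, hre, ?_⟩
  have hz0 : z ≠ 0 := fun h ↦ by simp [h] at hre
  have hK0 : (K : ℂ) ≠ 0 := Complex.ofReal_ne_zero.mpr hKpos.ne'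
  have h : (K / 2 : ℝ) * (z * ∫ ω : ℝ, (g ω : ℂ) / (z - Complex.I * ω)) = z := hfix
  rw [eq_div_iff hK0]
  refine mul_left_cancel₀ hz0 ?_
  push_cast at h
  linear_combination 2 * h
end

section
/- Let g : ℝ → ℝ be an even, unimodal integrable function (g(−ω) = g(ω) for all ω, and g(ω₁) > g(ω₂) whenever 0 ≤ ω₁ < ω₂). Then for every x > 0 and y ∈ ℝ, the integral I(x,y) := ∫_ℝ (ω − y)/(x² + (ω − y)²) · g(ω) dω satisfies: I(x,y) < 0 if y > 0, I(x,y) > 0 if y < 0, and I(x,0) = 0. In particular y = 0 is the unique root of y ↦ I(x,y). -/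
open MeasureTheory Filter

lemma abs_div_sq_add_sq_le {x : ℝ} (hx : 0 < x) (t : ℝ) :
    |t / (x ^ 2 + t ^ 2)| ≤ 1 / (2 * x) := by
  have hpos : 0 < x ^ 2 + t ^ 2 := by positivity
  rw [abs_div, abs_of_pos hpos, div_le_div_iff₀ hpos (by positivity), ← sq_abs t]
  nlinarith [sq_nonneg (x - |t|)]

lemma integrable_div_sq_add_sq_mul {f : ℝ → ℝ} (hf : Integrable f) {x : ℝ} (hx : 0 < x) :
    Integrable fun t : ℝ => t / (x ^ 2 + t ^ 2) * f t :=
  hf.bdd_mul (c := 1 / (2 * x)) (by fun_prop : Measurable _).aestronglyMeasurable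
    (ae_of_all _ fun t => abs_div_sq_add_sq_le hx t)

lemma lt_of_abs_lt_abs {g : ℝ → ℝ} (heven : ∀ ω : ℝ, g (-ω) = g ω)
    (hunimodal : ∀ ω₁ ω₂ : ℝ, 0 ≤ ω₁ → ω₁ < ω₂ → g ω₂ < g ω₁)
    {a b : ℝ} (hab : |a| < |b|) : g b < g a := by
  have habs : ∀ c, g |c| = g c := fun c => by
    rcases abs_choice c with h | h <;> rw [h]
    exact heven c
  simpa only [habs] using hunimodal |a| |b| (abs_nonneg a) hab

lemma integral_conjugate_kernel_lt_zero {g : ℝ → ℝ} (hint : Integrable g)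
    (heven : ∀ ω : ℝ, g (-ω) = g ω)
    (hunimodal : ∀ ω₁ ω₂ : ℝ, 0 ≤ ω₁ → ω₁ < ω₂ → g ω₂ < g ω₁)
    {x : ℝ} (hx : 0 < x) {y : ℝ} (hy : 0 < y) :
    (∫ ω : ℝ, (ω - y) / (x ^ 2 + (ω - y) ^ 2) * g ω) < 0 := by
  have hadd := integrable_div_sq_add_sq_mul (hint.comp_add_left y) hx
  have hsub := integrable_div_sq_add_sq_mul (hint.comp_sub_left y) hx
  have hshift : (∫ ω : ℝ, (ω - y) / (x ^ 2 + (ω - y) ^ 2) * g ω) =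
      ∫ t : ℝ, t / (x ^ 2 + t ^ 2) * g (y + t) := by
    rw [← integral_sub_right_eq_self (fun t : ℝ => t / (x ^ 2 + t ^ 2) * g (y + t)) y]
    simp only [add_sub_cancel]
  have hreflect : (∫ t : ℝ, t / (x ^ 2 + t ^ 2) * g (y + t)) =
      -∫ t : ℝ, t / (x ^ 2 + t ^ 2) * g (y - t) := by
    rw [← integral_neg_eq_self, ← integral_neg]
    simp only [neg_sq, neg_div, neg_mul, ← sub_eq_add_neg]
  have hpos : ∀ t : ℝ, t ≠ 0 →
      0 < t / (x ^ 2 + t ^ 2) * g (y - t) - t / (x ^ 2 + t ^ 2) * g (y + t) := by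
    intro t ht
    rw [← mul_sub]
    rcases lt_or_gt_of_ne ht with ht | ht
    · refine mul_pos_of_neg_of_neg (div_neg_of_neg_of_pos ht (by positivity)) (sub_neg.2 ?_)
      exact lt_of_abs_lt_abs heven hunimodal (sq_lt_sq.1 (by nlinarith))
    · refine mul_pos (by positivity) (sub_pos.2 ?_)
      exact lt_of_abs_lt_abs heven hunimodal (sq_lt_sq.1 (by nlinarith))
  have hdiff : 0 < ∫ t : ℝ,
      (t / (x ^ 2 + t ^ 2) * g (y - t) - t / (x ^ 2 + t ^ 2) * g (y + t)) := by
    refine (integral_pos_iff_support_of_nonneg ?_ (hsub.sub hadd)).2 ?_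
    · intro t
      rcases eq_or_ne t 0 with rfl | ht
      · simp
      · exact (hpos t ht).le
    · refine lt_of_lt_of_le ?_ (measure_mono (s := Set.Ioi (0 : ℝ)) fun t ht =>
        (hpos t (ne_of_gt ht)).ne')
      simp
  rw [integral_sub hsub hadd] at hdiff
  linarith

lemma integral_conjugate_kernel_odd {g : ℝ → ℝ} (heven : ∀ ω : ℝ, g (-ω) = g ω)
    (x y : ℝ) :
    (∫ ω : ℝ, (ω - -y) / (x ^ 2 + (ω - -y) ^ 2) * g ω) =
      -∫ ω : ℝ, (ω - y) / (x ^ 2 + (ω - y) ^ 2) * g ω := by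
  rw [← integral_neg_eq_self, ← integral_neg]
  refine integral_congr_ae (ae_of_all _ fun ω => ?_)
  have h : -ω - -y = -(ω - y) := by ring
  simp only [h, heven, neg_sq, neg_div, neg_mul]

/-- **(after Theorem 3.5, following Mirollo–Strogatz).** For an even unimodal
integrable `g` and `x > 0`, the integral
`I(x,y) = ∫ (ω − y)/(x² + (ω − y)²) g(ω) dω` is negative for `y > 0`, positive
for `y < 0`, zero for `y = 0`; in particular `y = 0` is its unique root. -/
theorem even_unimodal_imaginary_part_sign
    (g : ℝ → ℝ) (hint : Integrable g)
    (heven : ∀ ω : ℝ, g (-ω) = g ω)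
    (hunimodal : ∀ ω₁ ω₂ : ℝ, 0 ≤ ω₁ → ω₁ < ω₂ → g ω₂ < g ω₁)
    (x : ℝ) (hx : 0 < x) (y : ℝ) :
    (0 < y → (∫ ω : ℝ, (ω - y) / (x ^ 2 + (ω - y) ^ 2) * g ω) < 0) ∧
    (y < 0 → 0 < ∫ ω : ℝ, (ω - y) / (x ^ 2 + (ω - y) ^ 2) * g ω) ∧
    (y = 0 → (∫ ω : ℝ, (ω - y) / (x ^ 2 + (ω - y) ^ 2) * g ω) = 0) ∧
    ((∫ ω : ℝ, (ω - y) / (x ^ 2 + (ω - y) ^ 2) * g ω) = 0 ↔ y = 0) := by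
  have hodd := integral_conjugate_kernel_odd heven x y
  have hneg : 0 < y → (∫ ω : ℝ, (ω - y) / (x ^ 2 + (ω - y) ^ 2) * g ω) < 0 :=
    integral_conjugate_kernel_lt_zero hint heven hunimodal hx
  have hpos : y < 0 → 0 < ∫ ω : ℝ, (ω - y) / (x ^ 2 + (ω - y) ^ 2) * g ω := fun hy => by
    have := integral_conjugate_kernel_lt_zero hint heven hunimodal hx (neg_pos.2 hy)
    linarith
  have hzero : y = 0 → (∫ ω : ℝ, (ω - y) / (x ^ 2 + (ω - y) ^ 2) * g ω) = 0 := by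
    rintro rfl
    rw [neg_zero] at hodd
    linarith
  refine ⟨hneg, hpos, hzero, fun h => ?_, hzero⟩
  rcases lt_trichotomy y 0 with hy | hy | hy
  · exact absurd h (hpos hy).ne'
  · exact hy
  · exact absurd h (hneg hy).ne
end

section
/- Let μ be a Borel probability measure on ℝ such that μ({y₀}) > 0 for some y₀ ∈ ℝ. Then there exists K₁ > 0 such that for every K with 0 < K < K₁ there exists λ ∈ ℂ with Re λ > 0 and ∫_ℝ (λ − iω)⁻¹ dμ(ω) = 2/K. In particular the infimum of the set of K > 0 for which the eigenvalue equation has a root in the right half plane is 0 (i.e., K_c = 0 when the frequency distribution has an atom). -/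
open MeasureTheory Filter

open scoped Topology NNReal

/-- In the disc of diameter `[a / 2, 3 * a / 2]`, scaled by `k`, the distance to a point of the
imaginary axis is comparable to the size of the data. -/
lemma sq_add_sq_le_six_mul_norm_sq {a k t : ℝ} (ha : 0 < a) {v : ℂ}
    (hv : v ∈ Metric.closedBall (a : ℂ) (a / 2)) :
    k ^ 2 * a ^ 2 + t ^ 2 ≤ 6 * ‖(k : ℂ) * v - Complex.I * t‖ ^ 2 := by
  rw [Metric.mem_closedBall, dist_eq_norm] at hv
  have hre : |v.re - a| ≤ a / 2 := by
    simpa using (Complex.abs_re_le_norm (v - a)).trans hv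
  have him : |v.im| ≤ a / 2 := by
    simpa using (Complex.abs_im_le_norm (v - a)).trans hv
  rw [abs_le] at hre
  have hx : a / 2 ≤ v.re := by linarith [hre.1]
  have hx2 : (a / 2) ^ 2 ≤ v.re ^ 2 := by gcongr
  have hy2 : v.im ^ 2 ≤ (a / 2) ^ 2 := sq_le_sq' (by linarith [(abs_le.1 him).1]) (abs_le.1 him).2
  have hk1 := mul_le_mul_of_nonneg_left hx2 (sq_nonneg k)
  have hk2 := mul_le_mul_of_nonneg_left hy2 (sq_nonneg k)
  rw [Complex.sq_norm, Complex.normSq_apply]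
  simp only [Complex.sub_re, Complex.sub_im, Complex.mul_re, Complex.mul_im, Complex.ofReal_re,
    Complex.ofReal_im, Complex.I_re, Complex.I_im]
  nlinarith [sq_nonneg (2 * (k * v.im) - t), sq_nonneg (k * v.im - t)]

lemma re_pos_of_mem_closedBall_half {a : ℝ} (ha : 0 < a) {v : ℂ}
    (hv : v ∈ Metric.closedBall (a : ℂ) (a / 2)) : 0 < v.re := by
  rw [Metric.mem_closedBall, dist_eq_norm] at hv
  have hre : |v.re - a| ≤ a / 2 := by
    simpa using (Complex.abs_re_le_norm (v - a)).trans hv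
  linarith [(abs_le.1 hre).1]

lemma re_le_norm_sub_I_mul (u : ℂ) (t : ℝ) : u.re ≤ ‖u - Complex.I * t‖ := by
  simpa using Complex.re_le_norm (u - Complex.I * t)

lemma sub_I_mul_ne_zero {u : ℂ} (hu : 0 < u.re) (t : ℝ) : u - Complex.I * t ≠ 0 :=
  norm_pos_iff.1 (hu.trans_le (re_le_norm_sub_I_mul u t))

lemma integrable_inv_sub_I_mul (μ : Measure ℝ) [IsFiniteMeasure μ] (y : ℝ) {u : ℂ}
    (hu : 0 < u.re) : Integrable (fun ω : ℝ => (u - Complex.I * ((ω - y : ℝ) : ℂ))⁻¹) μ := by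
  refine Integrable.of_bound (C := u.re⁻¹) (by fun_prop) (ae_of_all _ fun ω => ?_)
  rw [norm_inv]
  exact inv_anti₀ hu (re_le_norm_sub_I_mul u _)

lemma norm_mul_abs_div_le {a k : ℝ} (ha : 0 < a) (hk : 0 < k) (t : ℝ) :
    ‖6 * (k * |t|) / (k ^ 2 * a ^ 2 + t ^ 2)‖ ≤ 3 / a := by
  have hden : 0 < k ^ 2 * a ^ 2 + t ^ 2 := by positivity
  rw [Real.norm_of_nonneg (by positivity), div_le_div_iff₀ hden ha, ← sq_abs t]
  nlinarith [sq_nonneg (k * a - |t|)]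

/-- The averaged kernel controlling the Lipschitz constant vanishes in the limit. -/
lemma tendsto_integral_mul_abs_div (μ : Measure ℝ) [IsFiniteMeasure μ] (y : ℝ) {a : ℝ}
    (ha : 0 < a) :
    Tendsto (fun k : ℝ => ∫ ω, 6 * (k * |ω - y|) / (k ^ 2 * a ^ 2 + (ω - y) ^ 2) ∂μ)
      (𝓝[>] 0) (𝓝 0) := by
  have key := tendsto_integral_filter_of_dominated_convergence (μ := μ) (l := 𝓝[>] (0 : ℝ))
    (F := fun k ω => 6 * (k * |ω - y|) / (k ^ 2 * a ^ 2 + (ω - y) ^ 2)) (f := fun _ => 0)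
    (fun _ => 3 / a) (Eventually.of_forall fun k => Measurable.aestronglyMeasurable (by fun_prop)) ?_
    (integrable_const _) ?_
  · simpa using key
  · filter_upwards [self_mem_nhdsWithin] with k hk
    exact ae_of_all _ fun ω => norm_mul_abs_div_le ha hk (ω - y)
  · refine ae_of_all _ fun ω => ?_
    by_cases h : ω - y = 0
    · simp [h]
    · have hden : (0 : ℝ) ^ 2 * a ^ 2 + (ω - y) ^ 2 ≠ 0 := by simpa using h
      have hc : ContinuousAt
          (fun k : ℝ => 6 * (k * |ω - y|) / (k ^ 2 * a ^ 2 + (ω - y) ^ 2)) 0 :=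
        ContinuousAt.div (by fun_prop) (by fun_prop) hden
      have ht := hc.tendsto
      simp only [zero_mul, mul_zero, zero_div] at ht
      exact ht.mono_left nhdsWithin_le_nhds

/-- The rescaled resolvent recovers the mass of an atom. -/
lemma tendsto_mul_integral_inv_sub_I_mul (μ : Measure ℝ) [IsFiniteMeasure μ] (y : ℝ) {a : ℝ}
    (ha : 0 < a) :
    Tendsto (fun k : ℝ => (k : ℂ) * a *
        ∫ ω, ((k : ℂ) * a - Complex.I * ((ω - y : ℝ) : ℂ))⁻¹ ∂μ)
      (𝓝[>] 0) (𝓝 (μ.real {y} : ℂ)) := by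
  have key := tendsto_integral_filter_of_dominated_convergence (μ := μ) (l := 𝓝[>] (0 : ℝ))
    (F := fun k ω => (k : ℂ) * a * ((k : ℂ) * a - Complex.I * ((ω - y : ℝ) : ℂ))⁻¹)
    (f := Set.indicator {y} fun _ => (1 : ℂ))
    (fun _ => 1) (Eventually.of_forall fun k => by fun_prop) ?_ (integrable_const _) ?_
  · simpa only [integral_const_mul, integral_indicator (measurableSet_singleton y),
      setIntegral_const, Complex.real_smul, mul_one] using key
  · filter_upwards [self_mem_nhdsWithin] with k hk
    refine ae_of_all _ fun ω => ?_
    have hka : 0 < k * a := mul_pos hk ha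
    have h := re_le_norm_sub_I_mul ((k : ℂ) * a) (ω - y)
    have hre : ((k : ℂ) * a).re = k * a := by simp
    have hnorm : ‖(k : ℂ) * a‖ = k * a := by
      rw [← Complex.ofReal_mul, Complex.norm_real, Real.norm_of_nonneg hka.le]
    rw [hre] at h
    rw [norm_mul, norm_inv, hnorm, ← div_eq_mul_inv]
    exact div_le_one_of_le₀ h (norm_nonneg _)
  · refine ae_of_all _ fun ω => ?_
    by_cases h : ω = y
    · subst h
      refine tendsto_const_nhds.congr' ?_
      filter_upwards [self_mem_nhdsWithin] with k hk
      have hk : (k : ℂ) ≠ 0 := Complex.ofReal_ne_zero.2 (ne_of_gt hk)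
      have ha' : (a : ℂ) ≠ 0 := Complex.ofReal_ne_zero.2 ha.ne'
      simp only [sub_self, Complex.ofReal_zero, mul_zero, sub_zero, Set.mem_singleton_iff,
        Set.indicator_of_mem]
      exact (mul_inv_cancel₀ (mul_ne_zero hk ha')).symm
    · have hy : ((ω - y : ℝ) : ℂ) ≠ 0 := Complex.ofReal_ne_zero.2 (sub_ne_zero.2 h)
      have hden : ((0 : ℝ) : ℂ) * a - Complex.I * ((ω - y : ℝ) : ℂ) ≠ 0 := by
        simpa only [Complex.ofReal_zero, zero_mul, zero_sub, neg_ne_zero] using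
          mul_ne_zero Complex.I_ne_zero hy
      have hc : ContinuousAt (fun k : ℝ =>
          (k : ℂ) * a * ((k : ℂ) * a - Complex.I * ((ω - y : ℝ) : ℂ))⁻¹) 0 :=
        ContinuousAt.mul (by fun_prop) (ContinuousAt.inv₀ (by fun_prop) hden)
      have ht := hc.tendsto
      simp only [Complex.ofReal_zero, zero_mul] at ht
      simpa [h] using ht.mono_left nhdsWithin_le_nhds

/-- The rescaled resolvent is Lipschitz on a disc in the right half plane. -/
lemma norm_mul_integral_sub_le (μ : Measure ℝ) [IsFiniteMeasure μ] (y : ℝ) {a k : ℝ}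
    (ha : 0 < a) (hk : 0 < k) {v w : ℂ} (hv : v ∈ Metric.closedBall (a : ℂ) (a / 2))
    (hw : w ∈ Metric.closedBall (a : ℂ) (a / 2)) :
    ‖(k : ℂ) * v * (∫ ω, ((k : ℂ) * v - Complex.I * ((ω - y : ℝ) : ℂ))⁻¹ ∂μ) -
      (k : ℂ) * w * (∫ ω, ((k : ℂ) * w - Complex.I * ((ω - y : ℝ) : ℂ))⁻¹ ∂μ)‖ ≤
      (∫ ω, 6 * (k * |ω - y|) / (k ^ 2 * a ^ 2 + (ω - y) ^ 2) ∂μ) * ‖v - w‖ := by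
  have hvre : 0 < ((k : ℂ) * v).re := by
    simpa using mul_pos hk (re_pos_of_mem_closedBall_half ha hv)
  have hwre : 0 < ((k : ℂ) * w).re := by
    simpa using mul_pos hk (re_pos_of_mem_closedBall_half ha hw)
  rw [← integral_const_mul, ← integral_const_mul,
    ← integral_sub ((integrable_inv_sub_I_mul μ y hvre).const_mul _)
      ((integrable_inv_sub_I_mul μ y hwre).const_mul _), ← integral_mul_const]
  have hint : Integrable (fun ω => 6 * (k * |ω - y|) / (k ^ 2 * a ^ 2 + (ω - y) ^ 2)) μ := by
    refine Integrable.of_bound (C := 3 / a) (Measurable.aestronglyMeasurable (by fun_prop))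
      (ae_of_all _ fun ω => norm_mul_abs_div_le ha hk (ω - y))
  refine norm_integral_le_of_norm_le (hint.mul_const _) (ae_of_all _ fun ω => ?_)
  have hv0 := sub_I_mul_ne_zero hvre (ω - y)
  have hw0 := sub_I_mul_ne_zero hwre (ω - y)
  have hvb := sq_add_sq_le_six_mul_norm_sq (k := k) (t := ω - y) ha hv
  have hwb := sq_add_sq_le_six_mul_norm_sq (k := k) (t := ω - y) ha hw
  generalize ω - y = t at *
  have heq : (k : ℂ) * v * ((k : ℂ) * v - Complex.I * t)⁻¹ -
      (k : ℂ) * w * ((k : ℂ) * w - Complex.I * t)⁻¹ =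
      -(Complex.I * t * k * (v - w)) /
        (((k : ℂ) * v - Complex.I * t) * ((k : ℂ) * w - Complex.I * t)) := by
    field_simp
    ring
  have hden : 0 < k ^ 2 * a ^ 2 + t ^ 2 := by positivity
  rw [heq, norm_div, norm_neg, norm_mul, norm_mul, norm_mul, norm_mul, Complex.norm_I, one_mul,
    Complex.norm_real, Complex.norm_real, Real.norm_eq_abs, Real.norm_of_nonneg hk.le]
  have hpv := norm_pos_iff.2 hv0
  have hpw := norm_pos_iff.2 hw0
  generalize ‖(k : ℂ) * v - Complex.I * t‖ = p at *
  generalize ‖(k : ℂ) * w - Complex.I * t‖ = q at *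
  have hpq : k ^ 2 * a ^ 2 + t ^ 2 ≤ 6 * (p * q) := by
    refine (sq_le_sq₀ hden.le (by positivity)).1 ?_
    calc (k ^ 2 * a ^ 2 + t ^ 2) ^ 2
        = (k ^ 2 * a ^ 2 + t ^ 2) * (k ^ 2 * a ^ 2 + t ^ 2) := sq _
      _ ≤ (6 * p ^ 2) * (6 * q ^ 2) := by gcongr
      _ = (6 * (p * q)) ^ 2 := by ring
  rw [div_mul_eq_mul_div, div_le_div_iff₀ (by positivity) hden]
  have hn : 0 ≤ k * |t| * ‖v - w‖ := by positivity
  nlinarith [mul_le_mul_of_nonneg_left hpq hn]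

/-- Near an atom, the resolvent transform attains every large real value. -/
lemma eventually_exists_integral_eq_inv (μ : Measure ℝ) [IsFiniteMeasure μ] (y : ℝ)
    (hy : 0 < μ.real {y}) :
    ∀ᶠ k : ℝ in 𝓝[>] 0, ∃ z : ℂ, 0 < z.re ∧
      (∫ ω, (z - Complex.I * ω)⁻¹ ∂μ) = (k : ℂ)⁻¹ := by
  set a := μ.real {y} with ha
  have hL := (tendsto_integral_mul_abs_div μ y hy).eventually_lt_const
    (show (0 : ℝ) < 1 / 2 by norm_num)
  have hC := (tendsto_mul_integral_inv_sub_I_mul μ y hy).eventually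
    (Metric.closedBall_mem_nhds _ (show 0 < a / 4 by positivity))
  filter_upwards [hL, hC, self_mem_nhdsWithin] with k hLk hCk hk
  have hk : 0 < k := hk
  set T : ℂ → ℂ := fun v =>
    (k : ℂ) * v * ∫ ω, ((k : ℂ) * v - Complex.I * ((ω - y : ℝ) : ℂ))⁻¹ ∂μ with hT
  set s := Metric.closedBall (a : ℂ) (a / 2) with hs
  have hlip : ∀ v ∈ s, ∀ w ∈ s, dist (T v) (T w) ≤ 1 / 2 * dist v w := fun v hv w hw => by
    rw [dist_eq_norm, dist_eq_norm]
    exact (norm_mul_integral_sub_le μ y hy hk hv hw).trans (by gcongr)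
  have has : (a : ℂ) ∈ s := Metric.mem_closedBall_self (by positivity)
  have hmaps : Set.MapsTo T s s := fun v hv => by
    have h1 := hlip v hv a has
    have h2 : dist (T a) a ≤ a / 4 := hCk
    have h3 : dist v a ≤ a / 2 := hv
    have h4 := dist_triangle (T v) (T a) a
    rw [hs, Metric.mem_closedBall]
    linarith
  have hcontr : ContractingWith (1 / 2 : ℝ≥0) (hmaps.restrict T s s) := by
    refine ⟨by rw [← NNReal.coe_lt_coe]; norm_num, LipschitzWith.of_dist_le_mul fun v w => ?_⟩
    simpa [Subtype.dist_eq] using hlip v v.2 w w.2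
  obtain ⟨v, hv, hfix, -⟩ := hcontr.exists_fixedPoint' Metric.isClosed_closedBall.isComplete
    hmaps has (edist_ne_top _ _)
  have hvre := re_pos_of_mem_closedBall_half hy hv
  have hv0 : v ≠ 0 := fun h => by simp [h] at hvre
  refine ⟨(k : ℂ) * v + Complex.I * y, by simpa using mul_pos hk hvre, ?_⟩
  have hshift : ∀ ω : ℝ, (k : ℂ) * v + Complex.I * y - Complex.I * ω =
      (k : ℂ) * v - Complex.I * ((ω - y : ℝ) : ℂ) := fun ω => by
    push_cast
    ring
  simp only [hshift]
  have hfix : (k : ℂ) * v * ∫ ω, ((k : ℂ) * v - Complex.I * ((ω - y : ℝ) : ℂ))⁻¹ ∂μ = v := hfix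
  refine eq_inv_of_mul_eq_one_right (mul_left_cancel₀ hv0 ?_)
  linear_combination hfix

/-- **Remark at the end of Section 3.** If the frequency distribution `μ` has an
atom, then for all sufficiently small `K > 0` the eigenvalue equation
`∫ (λ − iω)⁻¹ dμ = 2/K` has a root in the right half plane; in particular the
infimum of the set of such coupling strengths `K` is `0` (i.e. `K_c = 0`). -/
theorem atom_gives_zero_transition_point
    (μ : Measure ℝ) [IsProbabilityMeasure μ]
    (y₀ : ℝ) (hatom : 0 < μ {y₀}) :
    (∃ K₁ : ℝ, 0 < K₁ ∧ ∀ K : ℝ, 0 < K → K < K₁ →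
      ∃ z : ℂ, 0 < z.re ∧
        (∫ ω, (z - Complex.I * ω)⁻¹ ∂μ) = 2 / (K : ℂ)) ∧
    sInf {K : ℝ | 0 < K ∧ ∃ z : ℂ, 0 < z.re ∧
      (∫ ω, (z - Complex.I * ω)⁻¹ ∂μ) = 2 / (K : ℂ)} = 0 := by
  have hpos : 0 < μ.real {y₀} := ENNReal.toReal_pos hatom.ne' (measure_ne_top _ _)
  obtain ⟨δ, hδ, hsub⟩ := mem_nhdsGT_iff_exists_Ioo_subset.1
    (eventually_exists_integral_eq_inv μ y₀ hpos)
  have hδ : 0 < δ := hδ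
  have hroot : ∀ K : ℝ, 0 < K → K < 2 * δ → ∃ z : ℂ, 0 < z.re ∧
      (∫ ω, (z - Complex.I * ω)⁻¹ ∂μ) = 2 / (K : ℂ) := fun K hK hKδ => by
    obtain ⟨z, hz, h⟩ := hsub (show K / 2 ∈ Set.Ioo 0 δ from ⟨by linarith, by linarith⟩)
    exact ⟨z, hz, by rw [h]; push_cast; rw [inv_div]⟩
  refine ⟨⟨2 * δ, by linarith, hroot⟩, le_antisymm (le_of_forall_pos_le_add fun ε hε => ?_)
    (Real.sInf_nonneg fun K hK => hK.1.le)⟩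
  have hm : 0 < min ε δ := lt_min hε hδ
  rw [zero_add]
  refine le_trans (csInf_le ?_ ?_) (min_le_left ε δ)
  · exact ⟨0, fun K hK => hK.1.le⟩
  · exact ⟨hm, hroot _ hm ((min_le_right _ _).trans_lt (by linarith))⟩
end

section
/- Let K > 0, let λ ∈ ℂ with Re λ < 0, and let g, φ : ℂ → ℂ be functions such that ω ↦ g(ω), ω ↦ φ(ω)·g(ω) and ω ↦ ω·φ(ω)·g(ω) are Lebesgue-integrable on ℝ. Suppose λ is a resonance pole, i.e. ∫_ℝ g(ω)/(λ − iω) dω + 2π·g(−iλ) = 2/K. Set c := ∫_ℝ φ(ω)g(ω) dω and define (T₁φ)(z) := iz·φ(z) + (K/2)·c. Then ∫_ℝ (T₁φ)(ω)·g(ω)/(λ − iω) dω + 2π·(T₁φ)(−iλ)·g(−iλ) = λ·( ∫_ℝ φ(ω)·g(ω)/(λ − iω) dω + 2π·φ(−iλ)·g(−iλ) ). In other words, the generalized eigenfunction μ(λ), defined by ⟨φ | μ(λ)⟩ = ∫_ℝ φ(ω)g(ω)/(λ − iω) dω + 2π φ(−iλ)g(−iλ), satisfies ⟨T₁φ | μ(λ)⟩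 = λ·⟨φ | μ(λ)⟩ for all such φ. -/
open MeasureTheory Filter

theorem sub_I_mul_ofReal_ne_zero {z : ℂ} (hz : z.re < 0) (ω : ℝ) : z - Complex.I * ω ≠ 0 := by
  intro h
  have hre := congrArg Complex.re h
  simp at hre
  exact hz.ne hre

theorem norm_inv_sub_I_mul_ofReal_le {z : ℂ} (hz : z.re < 0) (ω : ℝ) :
    ‖(z - Complex.I * ω)⁻¹‖ ≤ |z.re|⁻¹ := by
  rw [norm_inv]
  refine inv_anti₀ (abs_pos.mpr hz.ne) ?_
  simpa using Complex.abs_re_le_norm (z - Complex.I * ω)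

theorem MeasureTheory.Integrable.div_sub_I_mul_ofReal {z : ℂ} (hz : z.re < 0) {f : ℝ → ℂ}
    (hf : Integrable f) : Integrable (fun ω : ℝ => f ω / (z - Complex.I * ω)) := by
  simp only [div_eq_mul_inv]
  refine hf.mul_bdd (c := |z.re|⁻¹) ?_ (.of_forall (norm_inv_sub_I_mul_ofReal_le hz))
  exact Measurable.aestronglyMeasurable (by fun_prop)

/-- **Theorem 5.6.** If `λ` is a resonance pole, i.e.
`∫ g(ω)/(λ − iω) dω + 2π g(−iλ) = 2/K` with `Re λ < 0`, then the generalized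
eigenfunction `μ(λ)`, acting by
`⟨φ | μ(λ)⟩ = ∫ φ(ω)g(ω)/(λ − iω) dω + 2π φ(−iλ)g(−iλ)`, satisfies
`⟨T₁φ | μ(λ)⟩ = λ ⟨φ | μ(λ)⟩` for `T₁φ(z) = izφ(z) + (K/2)∫ φ g`. -/
theorem generalized_eigenfunction_at_resonance_pole
    (K : ℝ) (hK : 0 < K) (z : ℂ) (hz : z.re < 0) (g φ : ℂ → ℂ)
    (hg : Integrable (fun ω : ℝ => g ω))
    (hφg : Integrable (fun ω : ℝ => φ ω * g ω))
    (hωφg : Integrable (fun ω : ℝ => (ω : ℂ) * φ ω * g ω))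
    (hres : (∫ ω : ℝ, g ω / (z - Complex.I * ω)) +
      2 * (Real.pi : ℂ) * g (-(Complex.I * z)) = 2 / (K : ℂ)) :
    (∫ ω : ℝ, (Complex.I * ω * φ ω + ((K : ℂ) / 2) * ∫ s : ℝ, φ s * g s) * g ω /
        (z - Complex.I * ω)) +
      2 * (Real.pi : ℂ) *
        (Complex.I * (-(Complex.I * z)) * φ (-(Complex.I * z)) +
          ((K : ℂ) / 2) * ∫ s : ℝ, φ s * g s) * g (-(Complex.I * z)) =
    z * ((∫ ω : ℝ, φ ω * g ω / (z - Complex.I * ω)) +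
      2 * (Real.pi : ℂ) * φ (-(Complex.I * z)) * g (-(Complex.I * z))) := by
  have hI : Complex.I * -(Complex.I * z) = z := by
    linear_combination -z * Complex.I_mul_I
  have hK' : (K : ℂ) ≠ 0 := by exact_mod_cast hK.ne'
  set c : ℂ := ∫ s : ℝ, φ s * g s with hc
  have hsplit : ∀ ω : ℝ,
      (Complex.I * ω * φ ω + (K : ℂ) / 2 * c) * g ω / (z - Complex.I * ω) =
        z * (φ ω * g ω / (z - Complex.I * ω)) - φ ω * g ω +
          (K : ℂ) / 2 * c * (g ω / (z - Complex.I * ω)) := by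
    intro ω
    have := sub_I_mul_ofReal_ne_zero hz ω
    field_simp
    ring
  have h₁ := (hφg.div_sub_I_mul_ofReal hz).const_mul z
  have h₂ := (hg.div_sub_I_mul_ofReal hz).const_mul ((K : ℂ) / 2 * c)
  simp only [hsplit]
  rw [integral_add (by exact h₁.sub hφg) h₂, integral_sub h₁ hφg, integral_const_mul,
    integral_const_mul, ← hc, hI]
  have hcancel : (K : ℂ) / 2 * c * (2 / K) = c := by field_simp
  linear_combination (K : ℂ) / 2 * c * hres + hcancel
end

section
/- For every λ ∈ ℂ with Re λ > 0, ∫_ℝ 1/( π·(1 + ω²)·(λ − iω) ) dω = 1/(λ + 1). Consequently, for the Lorentzian density g(ω) = 1/(π(1 + ω²)) one has D(λ) = 1/(λ+1) on the right half plane; its analytic continuation has the unique root λ = K/2 − 1 of D(λ) = 2/K, so the linearized order parameter decays at the exponential rate e^{(K/2 − 1)t} for 0 < K < 2 and the transition point is K_c = 2/(π g(0)) = 2. -/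
open MeasureTheory Filter

namespace Complex

lemma re_sub_I_mul_ofReal (z : ℂ) (ω : ℝ) : (z - I * ω).re = z.re := by simp

lemma sub_I_mul_ofReal_ne_zero {z : ℂ} (hz : 0 < z.re) (ω : ℝ) : z - I * ω ≠ 0 := by
  intro h
  have := re_sub_I_mul_ofReal z ω
  simp [h] at this
  exact hz.ne this

lemma div_mem_slitPlane_of_re_pos {a b : ℂ} (ha : 0 < a.re) (hb : 0 < b.re) :
    a / b ∈ slitPlane := by
  rw [mem_slitPlane_iff_not_le_zero]
  intro h
  have hb0 : b ≠ 0 := by rintro rfl; simp at hb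
  obtain ⟨hre, him⟩ := le_def.mp h
  have hab : a = a / b * b := (div_mul_cancel₀ a hb0).symm
  have hre' := congrArg re hab
  rw [mul_re, him] at hre'
  simp only [zero_re, zero_im, zero_mul, sub_zero] at hre hre'
  nlinarith

lemma hasDerivAt_sub_I_mul_ofReal (z : ℂ) (ω : ℝ) :
    HasDerivAt (fun x : ℝ => z - I * x) (-I) ω := by
  simpa using ((hasDerivAt_id ω).ofReal_comp.const_mul I).const_sub z

lemma tendsto_inv_sub_I_mul_ofReal (z : ℂ) :
    Tendsto (fun ω : ℝ => (z - I * ω)⁻¹) (cocompact ℝ) (nhds 0) := by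
  refine tendsto_inv₀_cobounded.comp (tendsto_norm_atTop_iff_cobounded.mp ?_)
  refine tendsto_atTop_mono (f := fun ω : ℝ => ‖ω‖ - ‖z‖) (fun ω => ?_)
    (tendsto_atTop_add_const_right _ _ (tendsto_norm_cocompact_atTop))
  have := norm_sub_norm_le (I * (ω : ℂ)) z
  rw [norm_sub_rev] at this
  simpa using this

lemma continuous_inv_sub_I_mul_ofReal {z : ℂ} (hz : 0 < z.re) :
    Continuous fun ω : ℝ => (z - I * ω)⁻¹ :=
  Continuous.inv₀ (by fun_prop) (sub_I_mul_ofReal_ne_zero hz)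

lemma norm_inv_sub_I_mul_ofReal_le {z : ℂ} (hz : 0 < z.re) (ω : ℝ) :
    ‖(z - I * ω)⁻¹‖ ≤ z.re⁻¹ := by
  rw [norm_inv]
  refine inv_anti₀ hz ?_
  simpa only [re_sub_I_mul_ofReal] using re_le_norm (z - I * ω)

lemma integrable_ofReal_inv_one_add_sq : Integrable fun ω : ℝ => (((1 + ω ^ 2)⁻¹ : ℝ) : ℂ) :=
  integrable_inv_one_add_sq.ofReal

lemma integrable_inv_one_add_sq_mul_inv_sub_I_mul {z : ℂ} (hz : 0 < z.re) :
    Integrable fun ω : ℝ => (((1 + ω ^ 2)⁻¹ : ℝ) : ℂ) * (z - I * ω)⁻¹ :=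
  integrable_ofReal_inv_one_add_sq.mul_bdd (c := z.re⁻¹)
    (continuous_inv_sub_I_mul_ofReal hz).aestronglyMeasurable
    (Eventually.of_forall (norm_inv_sub_I_mul_ofReal_le hz))

lemma integral_inv_sub_I_mul_mul_inv_sub_I_mul {a b : ℂ} (ha : 0 < a.re) (hb : 0 < b.re)
    (hint : Integrable fun ω : ℝ => (a - I * ω)⁻¹ * (b - I * ω)⁻¹) :
    ∫ ω : ℝ, (a - I * ω)⁻¹ * (b - I * ω)⁻¹ = 0 := by
  suffices h : ∃ F : ℝ → ℂ, (∀ ω : ℝ, HasDerivAt F ((a - I * ω)⁻¹ * (b - I * ω)⁻¹) ω) ∧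
      Tendsto F (cocompact ℝ) (nhds 0) by
    obtain ⟨F, hF, hlim⟩ := h
    simpa using integral_of_hasDerivAt_of_tendsto hF hint
      (hlim.mono_left atBot_le_cocompact) (hlim.mono_left atTop_le_cocompact)
  rcases eq_or_ne a b with rfl | hab
  · refine ⟨fun ω => -I * (a - I * ω)⁻¹, fun ω => ?_, ?_⟩
    · have h0 := sub_I_mul_ofReal_ne_zero ha ω
      refine (((hasDerivAt_sub_I_mul_ofReal a ω).fun_inv h0).const_mul (-I)).congr_deriv ?_
      field_simp
      simp
    · simpa using (tendsto_inv_sub_I_mul_ofReal a).const_mul (-I)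
  · have hba : b - a ≠ 0 := sub_ne_zero.mpr hab.symm
    refine ⟨fun ω => I / (b - a) * log ((a - I * ω) / (b - I * ω)), fun ω => ?_, ?_⟩
    · have h0 := sub_I_mul_ofReal_ne_zero ha ω
      have h1 := sub_I_mul_ofReal_ne_zero hb ω
      have hs : (a - I * ω) / (b - I * ω) ∈ slitPlane :=
        div_mem_slitPlane_of_re_pos (by simpa using ha) (by simpa using hb)
      refine ((((hasDerivAt_sub_I_mul_ofReal a ω).fun_div
        (hasDerivAt_sub_I_mul_ofReal b ω) h1).clog_real hs).const_mul (I / (b - a))).congr_deriv ?_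
      field_simp
      linear_combination (a - b) * I_sq
    · have hq : Tendsto (fun ω : ℝ => (a - I * ω) / (b - I * ω)) (cocompact ℝ) (nhds 1) := by
        have := ((tendsto_inv_sub_I_mul_ofReal b).const_mul (a - b)).const_add 1
        rw [mul_zero, add_zero] at this
        refine this.congr fun ω => ?_
        have h1 := sub_I_mul_ofReal_ne_zero hb ω
        field_simp
        ring
      simpa using (hq.clog one_mem_slitPlane).const_mul (I / (b - a))

theorem integral_inv_one_add_sq_mul_inv_sub_I_mul {z : ℂ} (hz : 0 < z.re) :
    ∫ ω : ℝ, (((1 + ω ^ 2)⁻¹ : ℝ) : ℂ) * (z - I * ω)⁻¹ = Real.pi / (z + 1) := by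
  have hz1 : z + 1 ≠ 0 := by
    intro h
    have := congrArg re h
    simp at this
    linarith
  have hdecomp (ω : ℝ) : (1 - I * ω)⁻¹ * (z - I * ω)⁻¹ =
      (z + 1) * ((((1 + ω ^ 2)⁻¹ : ℝ) : ℂ) * (z - I * ω)⁻¹) - (((1 + ω ^ 2)⁻¹ : ℝ) : ℂ) := by
    have h1 := sub_I_mul_ofReal_ne_zero (z := 1) (by simp) ω
    have h2 := sub_I_mul_ofReal_ne_zero hz ω
    have h3 : 1 + I * (ω : ℂ) ≠ 0 := by
      simpa using sub_I_mul_ofReal_ne_zero (z := 1) (by simp) (-ω)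
    have h4 : (((1 + ω ^ 2)⁻¹ : ℝ) : ℂ) = (1 - I * ω)⁻¹ * (1 + I * ω)⁻¹ := by
      rw [← mul_inv]
      push_cast
      congr 1
      linear_combination (ω : ℂ) ^ 2 * I_sq
    rw [h4]
    field_simp
    ring
  have hint := (integrable_inv_one_add_sq_mul_inv_sub_I_mul hz).const_mul (z + 1)
  have hzero := integral_inv_sub_I_mul_mul_inv_sub_I_mul (a := 1) (by simp) hz
    ((hint.sub integrable_ofReal_inv_one_add_sq).congr
      (Eventually.of_forall fun ω => (hdecomp ω).symm))
  simp_rw [hdecomp] at hzero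
  rw [integral_sub hint integrable_ofReal_inv_one_add_sq, integral_const_mul, integral_complex_ofReal,
    integral_univ_inv_one_add_sq] at hzero
  rw [eq_div_iff hz1]
  linear_combination hzero

end Complex

/-- **Example 4.7 / Theorem 4.6 (Lorentzian case).** For the Lorentzian density
`g(ω) = 1/(π(1 + ω²))` one has `D(λ) = ∫ g(ω)/(λ − iω) dω = 1/(λ + 1)` on the
right half plane; the transition point is `K_c = 2/(π g(0)) = 2`, and the
analytic continuation `1/(λ + 1)` has the unique root `λ = K/2 − 1` of the
equation `D(λ) = 2/K`. -/
theorem lorentzian_resolvent_and_resonance_pole :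
    (∀ z : ℂ, 0 < z.re →
      (∫ ω : ℝ, 1 / ((Real.pi : ℂ) * (1 + (ω : ℂ) ^ 2) * (z - Complex.I * ω))) =
        1 / (z + 1)) ∧
    (2 / (Real.pi * (1 / (Real.pi * (1 + (0 : ℝ) ^ 2)))) = 2) ∧
    (∀ K : ℝ, 0 < K →
      (1 : ℂ) / (((K : ℂ) / 2 - 1) + 1) = 2 / (K : ℂ) ∧
      ∀ w : ℂ, w ≠ -1 →
        ((1 : ℂ) / (w + 1) = 2 / (K : ℂ) ↔ w = (K : ℂ) / 2 - 1)) := by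
  refine ⟨fun z hz => ?_, ?_, fun K hK => ?_⟩
  · have hpi : (Real.pi : ℂ) ≠ 0 := Complex.ofReal_ne_zero.mpr Real.pi_ne_zero
    calc _ = ∫ ω : ℝ, (Real.pi : ℂ)⁻¹ *
          ((((1 + ω ^ 2)⁻¹ : ℝ) : ℂ) * (z - Complex.I * ω)⁻¹) := by
          congr 1 with ω
          push_cast
          rw [one_div, mul_inv, mul_inv, mul_assoc]
      _ = 1 / (z + 1) := by
          rw [integral_const_mul, Complex.integral_inv_one_add_sq_mul_inv_sub_I_mul hz,
            ← mul_div_assoc, inv_mul_cancel₀ hpi]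
  · field_simp
    norm_num
  · have hK0 : (K : ℂ) ≠ 0 := Complex.ofReal_ne_zero.mpr hK.ne'
    refine ⟨by rw [sub_add_cancel, one_div_div], fun w hw => ?_⟩
    have hw1 : w + 1 ≠ 0 := fun h => hw (eq_neg_of_add_eq_zero_left h)
    rw [div_eq_div_iff hw1 hK0]
    constructor <;> intro h
    · linear_combination -h / 2
    · linear_combination -2 * h
end

section
/- Define F : ℝ → ℝ by F(λ) = e^{λ²/2}·( √(π/2) − ∫₀^λ e^{−x²/2} dx ). Then for every K with 0 < K < 2·√(2/π), there exists a unique λ ∈ (−∞, 0] with F(λ) = 2/K, and this λ is strictly negative. (For the Gaussian frequency distribution and 0 < K < K_c, there is exactly one resonance pole on the real axis.) -/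
open MeasureTheory Filter intervalIntegral

lemma continuous_exp_neg_sq_div_two : Continuous fun x : ℝ => Real.exp (-x ^ 2 / 2) := by
  fun_prop

lemma strictMono_integral_exp_neg_sq_div_two :
    StrictMono fun l : ℝ => ∫ x in (0:ℝ)..l, Real.exp (-x ^ 2 / 2) := by
  intro a b hab
  have hint (u v : ℝ) : IntervalIntegrable (fun x : ℝ => Real.exp (-x ^ 2 / 2)) volume u v :=
    continuous_exp_neg_sq_div_two.intervalIntegrable u v
  have hpos : 0 < ∫ x in a..b, Real.exp (-x ^ 2 / 2) :=
    intervalIntegral_pos_of_pos (hint a b) (fun _ => Real.exp_pos _) hab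
  have hadd := integral_add_adjacent_intervals (hint 0 a) (hint a b)
  dsimp only
  linarith

lemma integral_exp_neg_sq_div_two_nonpos {l : ℝ} (hl : l ≤ 0) :
    ∫ x in (0:ℝ)..l, Real.exp (-x ^ 2 / 2) ≤ 0 := by
  simpa using strictMono_integral_exp_neg_sq_div_two.monotone hl

lemma continuous_integral_exp_neg_sq_div_two :
    Continuous fun l : ℝ => ∫ x in (0:ℝ)..l, Real.exp (-x ^ 2 / 2) :=
  continuous_primitive (fun u v => continuous_exp_neg_sq_div_two.intervalIntegrable u v) 0

lemma strictAntiOn_exp_mul_sub_integral {c : ℝ} (hc : 0 < c) :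
    StrictAntiOn (fun l : ℝ => Real.exp (l ^ 2 / 2) *
      (c - ∫ x in (0:ℝ)..l, Real.exp (-x ^ 2 / 2))) (Set.Iic 0) := by
  intro a _ b hb hab
  have hb0 : b ≤ 0 := hb
  have hI := strictMono_integral_exp_neg_sq_div_two hab
  have hIb := integral_exp_neg_sq_div_two_nonpos hb0
  have hsq : b ^ 2 / 2 < a ^ 2 / 2 := by nlinarith
  dsimp only at hI ⊢
  exact mul_lt_mul'' (Real.exp_lt_exp.2 hsq) (by linarith) (Real.exp_pos _).le (by linarith)

lemma neg_le_exp_mul_sub_integral {c l : ℝ} (hc : 1 ≤ c) (hl : l ≤ 0) :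
    -l ≤ Real.exp (l ^ 2 / 2) * (c - ∫ x in (0:ℝ)..l, Real.exp (-x ^ 2 / 2)) := by
  have hI := integral_exp_neg_sq_div_two_nonpos hl
  calc -l ≤ l ^ 2 / 2 + 1 := by nlinarith [sq_nonneg (l + 1)]
    _ ≤ Real.exp (l ^ 2 / 2) := Real.add_one_le_exp _
    _ ≤ _ := le_mul_of_one_le_right (Real.exp_pos _).le (by linarith)

/-- **Proposition A.3.** For the Gaussian distribution and `0 < K < K_c = 2√(2/π)`,
the function `F(λ) = e^{λ²/2}(√(π/2) − ∫₀^λ e^{−x²/2} dx)` takes the value `2/K`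
at exactly one point `λ ≤ 0`, and this point is strictly negative: there is
exactly one resonance pole on the real axis. -/
theorem gaussian_unique_real_resonance_pole
    (K : ℝ) (hK0 : 0 < K) (hK : K < 2 * Real.sqrt (2 / Real.pi)) :
    ∃ l : ℝ, l < 0 ∧
      Real.exp (l ^ 2 / 2) *
        (Real.sqrt (Real.pi / 2) - ∫ x in (0:ℝ)..l, Real.exp (-x ^ 2 / 2)) = 2 / K ∧
      ∀ l' : ℝ, l' ≤ 0 →
        Real.exp (l' ^ 2 / 2) *
          (Real.sqrt (Real.pi / 2) - ∫ x in (0:ℝ)..l', Real.exp (-x ^ 2 / 2)) = 2 / K →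
        l' = l := by
  have hc : 1 ≤ Real.sqrt (Real.pi / 2) :=
    Real.one_le_sqrt.2 (by linarith [Real.pi_gt_three])
  have hcK : Real.sqrt (Real.pi / 2) < 2 / K := by
    rw [← inv_div Real.pi 2, Real.sqrt_inv, ← div_eq_mul_inv, lt_div_iff₀ (by positivity)] at hK
    rwa [lt_div_iff₀ hK0, mul_comm]
  generalize Real.sqrt (Real.pi / 2) = c at hc hcK ⊢
  have hanti := strictAntiOn_exp_mul_sub_integral (zero_lt_one.trans_le hc)
  have hcont : Continuous fun l : ℝ => Real.exp (l ^ 2 / 2) *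
      (c - ∫ x in (0:ℝ)..l, Real.exp (-x ^ 2 / 2)) :=
    (by fun_prop : Continuous fun l : ℝ => Real.exp (l ^ 2 / 2)).mul
      (continuous_const.sub continuous_integral_exp_neg_sq_div_two)
  have hM : -(2 / K) ≤ 0 := by
    have : 0 < 2 / K := by positivity
    linarith
  have hleft := neg_le_exp_mul_sub_integral hc hM
  rw [neg_neg] at hleft
  obtain ⟨l, hl, hFl⟩ := intermediate_value_Icc' hM hcont.continuousOn
    (show 2 / K ∈ Set.Icc _ _ from ⟨by simpa using hcK.le, hleft⟩)
  refine ⟨l, lt_of_le_of_ne hl.2 ?_, hFl, fun l' hl' hFl' =>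
    hanti.injOn hl' hl.2 (hFl'.trans hFl.symm)⟩
  rintro rfl
  simp at hFl
  linarith
end

section
/- Let E : ℂ → ℂ be defined by E(λ) = ∫₀¹ λ·exp(−(sλ)²/2) ds (the entire antiderivative of z ↦ e^{−z²/2} with E(0) = 0), fix K > 0, and define f : ℂ → ℂ by f(λ) = e^{λ²/2}·(√(π/2) − E(λ)) − 2/K. Then: (a) if f(λ₀) = 0, then f has derivative (2/K)·λ₀ − 1 at λ₀; (b) consequently every zero λ₀ of f with Re λ₀ ≤ 0 is a simple zero, i.e., the derivative of f at λ₀ is nonzero. (All resonance poles of the Gaussian distribution are poles of first order, so the Gaussian satisfies assumption (A4).) -/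
open MeasureTheory Filter intervalIntegral

/-- For an entire function `g`, the function `z ↦ ∫ s in 0..1, z • g (s z)` is a primitive of `g`. -/
theorem Differentiable.hasDerivAt_integral_segment {g : ℂ → ℂ} (hg : Differentiable ℂ g) (z₀ : ℂ) :
    HasDerivAt (fun z : ℂ => ∫ s in (0:ℝ)..1, z * g ((s : ℂ) * z)) (g z₀) z₀ := by
  obtain ⟨G, hG⟩ := hg.isExactOn_univ
  have hseg (z : ℂ) : ∫ s in (0:ℝ)..1, z * g ((s : ℂ) * z) = G z - G 0 := by
    have hcont : Continuous fun s : ℝ => z * g ((s : ℂ) * z) :=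
      continuous_const.mul
        (hg.continuous.comp (Complex.continuous_ofReal.mul continuous_const))
    have hderiv (s : ℝ) :
        HasDerivAt (fun s : ℝ => G ((s : ℂ) * z)) (z * g ((s : ℂ) * z)) s := by
      have hline : HasDerivAt (fun w : ℂ => w * z) z (s : ℂ) := by
        simpa using (hasDerivAt_id (s : ℂ)).mul_const z
      have hcomp := ((hG _ (Set.mem_univ ((s : ℂ) * z))).comp (s : ℂ) hline).comp_ofReal
      rw [mul_comm]
      exact hcomp
    rw [integral_eq_sub_of_hasDerivAt (fun s _ => hderiv s) (hcont.intervalIntegrable 0 1)]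
    simp
  simp_rw [hseg]
  exact (hG z₀ (Set.mem_univ z₀)).sub_const (G 0)

/-- **Proposition A.4.** Let `E(λ) = ∫₀¹ λ e^{−(sλ)²/2} ds` (the entire
antiderivative of `e^{−z²/2}` vanishing at `0`) and
`f(λ) = e^{λ²/2}(√(π/2) − E(λ)) − 2/K`. Then at any zero `λ₀` of `f` the
derivative of `f` equals `(2/K)λ₀ − 1`; hence every zero with `Re λ₀ ≤ 0` is
simple. All resonance poles of the Gaussian distribution are of first order,
so the Gaussian satisfies assumption (A4). -/
theorem gaussian_resonance_poles_are_simple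
    (K : ℝ) (hK : 0 < K) :
    ∀ z₀ : ℂ,
      Complex.exp (z₀ ^ 2 / 2) *
          ((Real.sqrt (Real.pi / 2) : ℂ) -
            ∫ s in (0:ℝ)..1, z₀ * Complex.exp (-((s : ℂ) * z₀) ^ 2 / 2)) -
        2 / (K : ℂ) = 0 →
      HasDerivAt (fun z : ℂ =>
          Complex.exp (z ^ 2 / 2) *
            ((Real.sqrt (Real.pi / 2) : ℂ) -
              ∫ s in (0:ℝ)..1, z * Complex.exp (-((s : ℂ) * z) ^ 2 / 2)) -
          2 / (K : ℂ))
        ((2 / (K : ℂ)) * z₀ - 1) z₀ ∧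
      (z₀.re ≤ 0 →
        deriv (fun z : ℂ =>
          Complex.exp (z ^ 2 / 2) *
            ((Real.sqrt (Real.pi / 2) : ℂ) -
              ∫ s in (0:ℝ)..1, z * Complex.exp (-((s : ℂ) * z) ^ 2 / 2)) -
          2 / (K : ℂ)) z₀ ≠ 0) := by
  intro z₀ hz₀
  have hK' : (K : ℂ) ≠ 0 := by exact_mod_cast hK.ne'
  have hE : HasDerivAt
      (fun z : ℂ => ∫ s in (0:ℝ)..1, z * Complex.exp (-((s : ℂ) * z) ^ 2 / 2))
      (Complex.exp (-z₀ ^ 2 / 2)) z₀ :=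
    Differentiable.hasDerivAt_integral_segment
      (g := fun w => Complex.exp (-w ^ 2 / 2)) (by fun_prop) z₀
  have hexp : HasDerivAt (fun z : ℂ => Complex.exp (z ^ 2 / 2))
      (Complex.exp (z₀ ^ 2 / 2) * z₀) z₀ := by
    have hsq : HasDerivAt (fun z : ℂ => z ^ 2 / 2) z₀ z₀ := by
      simpa using (hasDerivAt_pow 2 z₀).div_const 2
    exact hsq.cexp
  have hcancel : Complex.exp (z₀ ^ 2 / 2) * Complex.exp (-z₀ ^ 2 / 2) = 1 := by
    rw [← Complex.exp_add, neg_div, add_neg_cancel, Complex.exp_zero]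
  have hf := (hexp.mul (hE.const_sub (Real.sqrt (Real.pi / 2) : ℂ))).sub_const (2 / (K : ℂ))
  have hderiv := hf.congr_deriv
    (g' := (2 / (K : ℂ)) * z₀ - 1) (by linear_combination z₀ * hz₀ - hcancel)
  refine ⟨hderiv, fun hre hzero => ?_⟩
  have heq : (2 / (K : ℂ)) * z₀ - 1 = 0 := hderiv.deriv.symm.trans hzero
  have hz : z₀ = ((K / 2 : ℝ) : ℂ) := by
    field_simp at heq
    push_cast
    linear_combination heq / 2
  rw [hz, Complex.ofReal_re] at hre
  linarith
end

section
/- Let E : ℂ → ℂ be defined by E(λ) = ∫₀¹ λ·exp(−(sλ)²/2) ds. Then for every K > 0, the set S_K := { λ ∈ ℂ : Re λ ≤ 0 and e^{λ²/2}·(√(π/2) − E(λ)) = 2/K } is infinite; moreover, for every R > 0 there exists λ ∈ S_K with Re λ < −R. (For the Gaussian frequency distribution there exist infinitely many resonance poles, and their real parts tend to −∞.) -/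
open MeasureTheory Filter intervalIntegral

/-- The primitive `E` of `z ↦ exp (-z ^ 2 / 2)` vanishing at `0`, as an integral over `[0, 1]`. -/
noncomputable def gaussPrimitive (z : ℂ) : ℂ :=
  ∫ s in (0:ℝ)..1, z * Complex.exp (-((s : ℂ) * z) ^ 2 / 2)

theorem hasDerivAt_gaussPrimitive (z : ℂ) :
    HasDerivAt gaussPrimitive (Complex.exp (-z ^ 2 / 2)) z := by
  obtain ⟨F, hF⟩ := Differentiable.isExactOn_univ
    (f := fun z : ℂ => Complex.exp (-z ^ 2 / 2)) (by fun_prop)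
  have hE : gaussPrimitive = fun w => F w - F 0 := by
    funext w
    have h : ∀ s ∈ Set.uIcc (0:ℝ) 1, HasDerivAt (fun s : ℝ => F ((s : ℂ) * w))
        (w * Complex.exp (-((s : ℂ) * w) ^ 2 / 2)) s := by
      intro s _
      have h1 : HasDerivAt (fun u : ℂ => F (u * w))
          (Complex.exp (-((s : ℂ) * w) ^ 2 / 2) * (1 * w)) (s : ℂ) :=
        HasDerivAt.comp (s : ℂ) (hF _ (Set.mem_univ _)) ((hasDerivAt_id _).mul_const w)
      simpa [mul_comm] using h1.comp_ofReal
    have := integral_eq_sub_of_hasDerivAt h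
      (Continuous.intervalIntegrable (by fun_prop) _ _)
    simpa [gaussPrimitive] using this
  rw [hE]
  exact (hF z (Set.mem_univ _)).sub_const _

theorem gaussPrimitive_neg (z : ℂ) : gaussPrimitive (-z) = -gaussPrimitive z := by
  simp [gaussPrimitive]

theorem norm_exp_neg_sq_div_two (z : ℂ) :
    ‖Complex.exp (-z ^ 2 / 2)‖ = Real.exp (-(z.re ^ 2 - z.im ^ 2) / 2) := by
  rw [Complex.norm_exp]
  congr 1
  have : (-z ^ 2 / 2 : ℂ).re = (-z ^ 2).re / 2 := by simp
  rw [this, Complex.neg_re, pow_two z, Complex.mul_re]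
  ring

theorem tendsto_gaussPrimitive_ofReal :
    Tendsto (fun T : ℝ => gaussPrimitive T) atTop (nhds (Real.sqrt (Real.pi / 2) : ℂ)) := by
  have hint : IntegrableOn (fun x : ℝ => Real.exp (-(1 / 2) * x ^ 2)) (Set.Ioi 0) :=
    (integrable_exp_neg_mul_sq (by norm_num)).integrableOn
  have h := intervalIntegral_tendsto_integral_Ioi 0 hint tendsto_id
  have hval : Real.sqrt (Real.pi / (1 / 2)) / 2 = Real.sqrt (Real.pi / 2) := by
    rw [show Real.pi / (1 / 2) = 2 ^ 2 * (Real.pi / 2) by ring, Real.sqrt_mul (by norm_num),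
      Real.sqrt_sq (by norm_num)]
    ring
  rw [integral_gaussian_Ioi, hval] at h
  have hE : ∀ T : ℝ, gaussPrimitive T =
      ((∫ x in (0:ℝ)..T, Real.exp (-(1 / 2) * x ^ 2) : ℝ) : ℂ) := by
    intro T
    have hd : ∀ x ∈ Set.uIcc (0:ℝ) T, HasDerivAt (fun x : ℝ => gaussPrimitive x)
        ((Real.exp (-(1 / 2) * x ^ 2) : ℝ) : ℂ) x := by
      intro x _
      have := (hasDerivAt_gaussPrimitive (x : ℂ)).comp_ofReal
      convert this using 1
      push_cast
      congr 1
      ring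
    rw [← intervalIntegral.integral_ofReal, integral_eq_sub_of_hasDerivAt hd
      (Continuous.intervalIntegrable (by fun_prop) _ _)]
    simp [gaussPrimitive]
  simp_rw [hE]
  exact (Complex.continuous_ofReal.tendsto _).comp h

theorem tendsto_gaussPrimitive_add_ofReal (w : ℂ) :
    Tendsto (fun t : ℝ => gaussPrimitive (w + t)) atTop
      (nhds (Real.sqrt (Real.pi / 2) : ℂ)) := by
  have hreal : Tendsto (fun t : ℝ => gaussPrimitive ((w.re + t : ℝ) : ℂ)) atTop
      (nhds (Real.sqrt (Real.pi / 2) : ℂ)) :=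
    tendsto_gaussPrimitive_ofReal.comp (tendsto_atTop_add_const_left _ _ tendsto_id)
  have hdiff : Tendsto (fun t : ℝ => gaussPrimitive (w + t) -
      gaussPrimitive ((w.re + t : ℝ) : ℂ)) atTop (nhds 0) := by
    have hlim : Tendsto (fun t : ℝ => Real.exp (-((w.re + t) ^ 2 - w.im ^ 2) / 2) * |w.im|)
        atTop (nhds 0) := by
      rw [← zero_mul |w.im|]
      refine (Real.tendsto_exp_atBot.comp ?_).mul_const _
      have h1 : Tendsto (fun t : ℝ => (w.re + t) ^ 2) atTop atTop :=
        (tendsto_pow_atTop two_ne_zero).comp (tendsto_atTop_add_const_left _ _ tendsto_id)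
      have h2 := (tendsto_atTop_add_const_right _ (-w.im ^ 2) h1).const_mul_atTop_of_neg
        (show (-(1 / 2) : ℝ) < 0 by norm_num)
      exact h2.congr fun t => by ring
    refine squeeze_zero_norm (fun t => ?_) hlim
    have hseg := Convex.norm_image_sub_le_of_norm_hasDerivWithin_le
      (f := fun y : ℝ => gaussPrimitive ((w.re + t : ℝ) + y * Complex.I))
      (f' := fun y : ℝ => Complex.exp (-((w.re + t : ℝ) + y * Complex.I) ^ 2 / 2) * Complex.I)
      (s := Set.uIcc 0 w.im) (x := 0) (y := w.im)
      (C := Real.exp (-((w.re + t) ^ 2 - w.im ^ 2) / 2)) ?_ ?_ (convex_uIcc _ _)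
      Set.left_mem_uIcc Set.right_mem_uIcc
    · have hw : ((w.re + t : ℝ) : ℂ) + w.im * Complex.I = w + t := by
        apply Complex.ext <;> simp
      simpa [hw, -Complex.ofReal_add] using hseg
    · intro y _
      have h1 : HasDerivAt (fun u : ℂ => ((w.re + t : ℝ) : ℂ) + u * Complex.I) Complex.I
          (y : ℂ) := by
        simpa using ((hasDerivAt_id (y : ℂ)).mul_const Complex.I).const_add ((w.re + t : ℝ) : ℂ)
      exact ((hasDerivAt_gaussPrimitive _).comp (y : ℂ) h1).comp_ofReal.hasDerivWithinAt
    · intro y hy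
      rw [norm_mul, Complex.norm_I, mul_one, norm_exp_neg_sq_div_two, Real.exp_le_exp]
      have hy2 : y ^ 2 ≤ w.im ^ 2 := by
        rw [sq_le_sq]
        simpa using Set.abs_sub_left_of_mem_uIcc hy
      simp
      linarith
  simpa using hreal.add hdiff

theorem norm_gaussPrimitive_add_ofReal_sub_le {w : ℂ} (hw : 0 < w.re) {t : ℝ} (ht : 0 ≤ t) :
    ‖gaussPrimitive (w + t) - gaussPrimitive w‖ ≤ ‖Complex.exp (-w ^ 2 / 2)‖ / w.re := by
  have hderiv (s : ℝ) : HasDerivAt (fun s : ℝ => gaussPrimitive (w + s) - gaussPrimitive w)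
      (Complex.exp (-(w + s) ^ 2 / 2)) s := by
    have h1 : HasDerivAt (fun u : ℂ => w + u) 1 (s : ℂ) := (hasDerivAt_id (s : ℂ)).const_add w
    simpa using
      ((hasDerivAt_gaussPrimitive _).comp (s : ℂ) h1).comp_ofReal.sub_const (gaussPrimitive w)
  have hB (s : ℝ) : HasDerivAt
      (fun s : ℝ => ‖Complex.exp (-w ^ 2 / 2)‖ / w.re * (1 - Real.exp (-w.re * s)))
      (‖Complex.exp (-w ^ 2 / 2)‖ * Real.exp (-w.re * s)) s := by
    have h1 : HasDerivAt (fun s : ℝ => -w.re * s) (-w.re) s := by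
      simpa using (hasDerivAt_id s).const_mul (-w.re)
    refine ((h1.exp.const_sub 1).const_mul (‖Complex.exp (-w ^ 2 / 2)‖ / w.re)).congr_deriv ?_
    field_simp
  have h := image_norm_le_of_norm_deriv_right_le_deriv_boundary (a := 0) (b := t)
    (fun s _ => (hderiv s).continuousAt.continuousWithinAt)
    (fun s _ => (hderiv s).hasDerivWithinAt) (by simp) hB ?_ (Set.right_mem_Icc.mpr ht)
  · refine h.trans (mul_le_of_le_one_right (by positivity) ?_)
    linarith [Real.exp_pos (-w.re * t)]
  · intro s _
    rw [norm_exp_neg_sq_div_two, norm_exp_neg_sq_div_two, ← Real.exp_add, Real.exp_le_exp]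
    simp
    nlinarith [sq_nonneg s]

/-- The analytic continuation `exp (z ^ 2 / 2) * (√(π / 2) - E z)`. -/
noncomputable def gaussResolvent (z : ℂ) : ℂ :=
  Complex.exp (z ^ 2 / 2) * ((Real.sqrt (Real.pi / 2) : ℂ) - gaussPrimitive z)

theorem differentiable_gaussResolvent : Differentiable ℂ gaussResolvent := by
  have h : Differentiable ℂ gaussPrimitive :=
    fun z => (hasDerivAt_gaussPrimitive z).differentiableAt
  unfold gaussResolvent
  fun_prop

theorem norm_gaussResolvent_le {w : ℂ} (hw : 0 < w.re) : ‖gaussResolvent w‖ ≤ 1 / w.re := by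
  have h : ‖(Real.sqrt (Real.pi / 2) : ℂ) - gaussPrimitive w‖ ≤
      ‖Complex.exp (-w ^ 2 / 2)‖ / w.re :=
    le_of_tendsto ((tendsto_gaussPrimitive_add_ofReal w).sub_const _).norm
      ((eventually_ge_atTop 0).mono fun _ => norm_gaussPrimitive_add_ofReal_sub_le hw)
  rw [gaussResolvent, norm_mul]
  calc _ ≤ ‖Complex.exp (w ^ 2 / 2)‖ * (‖Complex.exp (-w ^ 2 / 2)‖ / w.re) := by gcongr
    _ = 1 / w.re := by
      rw [← mul_div_assoc, ← norm_mul, ← Complex.exp_add]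
      simp [neg_div]

theorem gaussResolvent_neg (z : ℂ) : gaussResolvent (-z) =
    2 * (Real.sqrt (Real.pi / 2) : ℂ) * Complex.exp (z ^ 2 / 2) - gaussResolvent z := by
  simp only [gaussResolvent, gaussPrimitive_neg, neg_sq]
  ring

theorem exists_exp_sq_div_two_eq {b : ℂ} (hb : b ≠ 0) (M : ℝ) :
    ∃ w : ℂ, M < w.re ∧ Complex.exp (w ^ 2 / 2) = b := by
  set a : ℂ := Complex.log b
  set B : ℝ := max M 1
  have hB : 0 < B := lt_of_lt_of_le one_pos (le_max_right _ _)
  obtain ⟨n, hn⟩ := exists_nat_gt (B ^ 2 + |a.re| + |a.im| + B ^ 2)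
  obtain ⟨w₀, hw₀⟩ := IsAlgClosed.exists_pow_nat_eq
    (2 * (a + n * (2 * Real.pi * Complex.I))) two_pos
  obtain ⟨w, hw, hpos⟩ : ∃ w : ℂ, w ^ 2 = 2 * (a + n * (2 * Real.pi * Complex.I)) ∧ 0 ≤ w.re := by
    rcases le_total 0 w₀.re with h | h
    · exact ⟨w₀, hw₀, h⟩
    · exact ⟨-w₀, by rwa [neg_sq], by simpa using h⟩
  refine ⟨w, ?_, ?_⟩
  · by_contra! hle
    have hwB : w.re ≤ B := hle.trans (le_max_left _ _)
    have hre := congrArg Complex.re hw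
    have him := congrArg Complex.im hw
    simp [pow_two] at hre him
    have h1 : w.re ^ 2 ≤ B ^ 2 := by gcongr
    have hpi := Real.pi_gt_three
    have hn0 : (0:ℝ) ≤ n := n.cast_nonneg
    have h3 : (n : ℝ) * 3 ≤ n * Real.pi := by gcongr
    nlinarith [neg_abs_le a.re, le_abs_self a.re, neg_abs_le a.im, le_abs_self a.im,
      sq_nonneg (w.re - w.im), abs_nonneg a.re, abs_nonneg a.im, sq_nonneg B]
  · rw [hw, mul_div_cancel_left₀ _ two_ne_zero, Complex.exp_add, Complex.exp_log hb,
      Complex.exp_nat_mul_two_pi_mul_I, mul_one]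

theorem exists_gaussResolvent_eq {c : ℝ} (hc : 0 < c) (R : ℝ) :
    ∃ z : ℂ, z.re < -R ∧ gaussResolvent z = c := by
  set q : ℂ := 2 * (Real.sqrt (Real.pi / 2) : ℂ) with hq_def
  have hq : q ≠ 0 := by
    have : Real.sqrt (Real.pi / 2) ≠ 0 := (Real.sqrt_pos.mpr (by positivity)).ne'
    simpa [hq_def] using this
  have hcC : (c : ℂ) ≠ 0 := by exact_mod_cast hc.ne'
  set M : ℝ := max R 0 + 64 / c + 2
  obtain ⟨w₀, hM, hexp⟩ := exists_exp_sq_div_two_eq (div_ne_zero hcC hq) M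
  have hdiv : 0 < 64 / c := by positivity
  have hw2 : 2 ≤ ‖w₀‖ := by
    have := Complex.re_le_norm w₀
    linarith [le_max_right R 0]
  have hw0 : w₀ ≠ 0 := norm_pos_iff.mp (by linarith)
  have hre (h : ℂ) (hh : ‖h‖ ≤ 1 / 2) : max R 0 + 64 / c < (w₀ + h / w₀).re := by
    have h1 : ‖h / w₀‖ ≤ 1 := by
      rw [norm_div]
      exact div_le_one_of_le₀ (by linarith) (norm_nonneg _)
    have h2 := Complex.abs_re_le_norm (h / w₀)
    rw [Complex.add_re]
    linarith [neg_abs_le (h / w₀).re]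
  have hsmall (h : ℂ) (hh : ‖h‖ ≤ 1 / 2) : ‖gaussResolvent (w₀ + h / w₀)‖ ≤ c / 64 := by
    have h1 : 64 / c ≤ (w₀ + h / w₀).re := by linarith [hre h hh, le_max_right R 0]
    refine (norm_gaussResolvent_le (hdiv.trans_le h1)).trans ?_
    calc 1 / (w₀ + h / w₀).re ≤ 1 / (64 / c) := by gcongr
      _ = c / 64 := one_div_div _ _
  set g : ℂ → ℂ := fun h => gaussResolvent (-(w₀ + h / w₀)) with hg
  have hgeq (h : ℂ) : g h = c * Complex.exp (h + h ^ 2 / (2 * w₀ ^ 2)) -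
      gaussResolvent (w₀ + h / w₀) := by
    have hsq : (w₀ + h / w₀) ^ 2 / 2 = w₀ ^ 2 / 2 + (h + h ^ 2 / (2 * w₀ ^ 2)) := by
      field_simp
      ring
    rw [hg]
    dsimp only
    rw [gaussResolvent_neg, hsq, Complex.exp_add, hexp, ← hq_def, ← mul_assoc,
      mul_div_cancel₀ _ hq]
  have hdiff : Differentiable ℂ g := by
    have := differentiable_gaussResolvent
    rw [hg]
    fun_prop
  have hg0 : ‖g 0 - c‖ ≤ c / 64 := by
    have := hsmall 0 (by simp)
    rw [hgeq]
    simpa using this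
  have hsphere : ∀ h ∈ Metric.sphere (0:ℂ) (1 / 2), 3 * c / 32 ≤ ‖g h - g 0‖ := by
    intro h hh
    have hn : ‖h‖ = 1 / 2 := by simpa using hh
    have hd : ‖h ^ 2 / (2 * w₀ ^ 2)‖ ≤ 1 / 32 := by
      rw [norm_div, norm_mul, norm_pow, norm_pow, hn, Complex.norm_ofNat,
        div_le_iff₀ (by positivity)]
      nlinarith
    set d : ℂ := h ^ 2 / (2 * w₀ ^ 2)
    have hv : ‖h + d‖ ≤ 17 / 32 := by linarith [norm_add_le h d]
    have he := Complex.norm_exp_sub_one_sub_id_le (x := h + d) (by linarith)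
    have he1 : 1 / 8 ≤ ‖Complex.exp (h + d) - 1‖ := by
      have h1 : h = (Complex.exp (h + d) - 1) -
          ((Complex.exp (h + d) - 1 - (h + d)) + d) := by ring
      have h2 := norm_sub_le (Complex.exp (h + d) - 1)
        ((Complex.exp (h + d) - 1 - (h + d)) + d)
      rw [← h1, hn] at h2
      have h3 := norm_add_le (Complex.exp (h + d) - 1 - (h + d)) d
      nlinarith [norm_nonneg (h + d)]
    have hs := hsmall h hn.le
    have hmain : (c : ℂ) * (Complex.exp (h + d) - 1) =
        (g h - g 0) + gaussResolvent (w₀ + h / w₀) + (g 0 - c) := by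
      rw [hgeq h]
      ring
    have hn1 : ‖(c : ℂ) * (Complex.exp (h + d) - 1)‖ = c * ‖Complex.exp (h + d) - 1‖ := by
      rw [norm_mul, Complex.norm_real, Real.norm_of_nonneg hc.le]
    rw [hmain] at hn1
    have := norm_add₃_le (a := g h - g 0) (b := gaussResolvent (w₀ + h / w₀)) (c := g 0 - c)
    nlinarith
  have hfreq : ∃ᶠ h in nhds (0:ℂ), g h ≠ g 0 := by
    intro hev
    have heq := AnalyticOnNhd.eq_of_eventuallyEq
      (fun z _ => hdiff.analyticAt z) (fun z _ => analyticAt_const (v := g 0))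
      (hev.mono fun z hz => not_not.mp hz)
    have h1 := hsphere (1 / 2) (by simp)
    rw [heq, sub_self, norm_zero] at h1
    linarith
  obtain ⟨h, hh, hval⟩ := hdiff.diffContOnCl.ball_subset_image_closedBall (by norm_num)
    hsphere hfreq (show (c : ℂ) ∈ Metric.ball (g 0) (3 * c / 32 / 2) by
      rw [Metric.mem_ball, dist_comm, dist_eq_norm]
      linarith)
  refine ⟨-(w₀ + h / w₀), ?_, hval⟩
  have := hre h (by simpa using hh)
  rw [Complex.neg_re]
  linarith [le_max_left R 0]

/-- **Proposition A.2.** Let `E(λ) = ∫₀¹ λ e^{−(sλ)²/2} ds`. For every `K > 0`,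
the set of resonance poles of the Gaussian distribution,
`S_K = {λ : Re λ ≤ 0, e^{λ²/2}(√(π/2) − E(λ)) = 2/K}`, is infinite; moreover
it contains points with arbitrarily negative real part. -/
theorem gaussian_infinitely_many_resonance_poles
    (K : ℝ) (hK : 0 < K) :
    {z : ℂ | z.re ≤ 0 ∧
        Complex.exp (z ^ 2 / 2) *
          ((Real.sqrt (Real.pi / 2) : ℂ) -
            ∫ s in (0:ℝ)..1, z * Complex.exp (-((s : ℂ) * z) ^ 2 / 2)) =
        2 / (K : ℂ)}.Infinite ∧
    ∀ R : ℝ, 0 < R → ∃ z : ℂ, z.re ≤ 0 ∧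
      Complex.exp (z ^ 2 / 2) *
        ((Real.sqrt (Real.pi / 2) : ℂ) -
          ∫ s in (0:ℝ)..1, z * Complex.exp (-((s : ℂ) * z) ^ 2 / 2)) =
      2 / (K : ℂ) ∧ z.re < -R := by
  have key (R : ℝ) (hR : 0 < R) : ∃ z : ℂ, z.re ≤ 0 ∧
      Complex.exp (z ^ 2 / 2) *
        ((Real.sqrt (Real.pi / 2) : ℂ) -
          ∫ s in (0:ℝ)..1, z * Complex.exp (-((s : ℂ) * z) ^ 2 / 2)) =
      2 / (K : ℂ) ∧ z.re < -R := by
    obtain ⟨z, hz, hval⟩ := exists_gaussResolvent_eq (div_pos two_pos hK) R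
    refine ⟨z, by linarith, ?_, hz⟩
    simpa [gaussResolvent, gaussPrimitive] using hval
  refine ⟨fun hfin => ?_, key⟩
  obtain ⟨m, hm⟩ := (hfin.image Complex.re).bddBelow
  obtain ⟨z, hz0, hz, hlt⟩ := key (|m| + 1) (by positivity)
  have := hm (Set.mem_image_of_mem _ ⟨hz0, hz⟩)
  linarith [neg_abs_le m]
end

section
/- Let g : ℝ → ℝ be a continuously differentiable, even probability density with g′(ω) ≤ 0 for all ω ≥ 0. Then for every x > 0, ∫₀^∞ ω/(x² + ω²) · g′(ω) dω < 0 (the integral exists because ∫₀^∞ |g′| = g(0) < ∞ and the kernel is bounded). Consequently the constant D₀ = −K_c·lim_{x→0⁺} ∫₀^∞ ω/(x² + ω²) g′(ω) dω appearing in the pitchfork bifurcation coefficient is nonnegative, and positive whenever the limit exists. -/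
open MeasureTheory Filter

/-- A nonnegative function that is antitone on a right half-line has a limit at infinity. -/
theorem exists_tendsto_atTop_of_antitoneOn_of_nonneg {g : ℝ → ℝ} (hg : AntitoneOn g (Set.Ici 0))
    (hnonneg : ∀ ω, 0 ≤ g ω) : ∃ l, Tendsto g atTop (nhds l) := by
  have hanti : Antitone fun ω => g (max ω 0) := fun a b hab =>
    hg (le_max_right a 0) (le_max_right b 0) (max_le_max_right 0 hab)
  have hbdd : BddBelow (Set.range fun ω => g (max ω 0)) :=
    ⟨0, by rintro _ ⟨ω, rfl⟩; exact hnonneg _⟩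
  refine ⟨_, (tendsto_atTop_ciInf hanti hbdd).congr' ?_⟩
  filter_upwards [eventually_ge_atTop 0] with ω hω
  rw [max_eq_left hω]

/-- An even `C¹` function with total integral `1` has nonzero derivative somewhere on `(0, ∞)`. -/
theorem not_forall_deriv_eq_zero_of_integral_eq_one {g : ℝ → ℝ} (hg : ContDiff ℝ 1 g)
    (hprob : ∫ ω : ℝ, g ω = 1) (heven : ∀ ω : ℝ, g (-ω) = g ω) :
    ¬ ∀ ω, 0 < ω → deriv g ω = 0 := by
  intro h
  have hdiff : Differentiable ℝ g := hg.differentiable one_ne_zero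
  have hpos : ∀ ω, 0 ≤ ω → g ω = g 0 := by
    intro ω hω
    have hanti : AntitoneOn g (Set.Ici 0) :=
      antitoneOn_of_deriv_nonpos (convex_Ici 0) hdiff.continuous.continuousOn
        hdiff.differentiableOn fun x hx => by
          rw [interior_Ici] at hx
          exact (h x hx).le
    have hmono : MonotoneOn g (Set.Ici 0) :=
      monotoneOn_of_deriv_nonneg (convex_Ici 0) hdiff.continuous.continuousOn
        hdiff.differentiableOn fun x hx => by
          rw [interior_Ici] at hx
          exact (h x hx).ge
    exact le_antisymm (hanti Set.self_mem_Ici hω hω) (hmono Set.self_mem_Ici hω hω)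
  have hconst : g = fun _ => g 0 := by
    funext ω
    rcases le_total 0 ω with hω | hω
    · exact hpos ω hω
    · rw [← heven ω]
      exact hpos (-ω) (by linarith)
  rw [hconst] at hprob
  simp [Measure.real] at hprob

/-- **Lemma 7.12 (the bifurcation constant `D₀` is positive).** For a `C¹` even
probability density `g` with `g′ ≤ 0` on `[0, ∞)`, one has
`∫₀^∞ ω/(x² + ω²) g′(ω) dω < 0` for every `x > 0`; consequently, whenever the
limit `L` of this integral as `x → 0⁺` exists, the constant
`D₀ = −K_c · L` (with `K_c = 2/(π g(0))`) is positive. -/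
theorem bifurcation_constant_positive
    (g : ℝ → ℝ) (hg : ContDiff ℝ 1 g) (hnonneg : ∀ ω, 0 ≤ g ω)
    (hprob : ∫ ω : ℝ, g ω = 1)
    (heven : ∀ ω : ℝ, g (-ω) = g ω)
    (hder : ∀ ω : ℝ, 0 ≤ ω → deriv g ω ≤ 0) :
    (∀ x : ℝ, 0 < x →
      (∫ ω in Set.Ioi (0 : ℝ), ω / (x ^ 2 + ω ^ 2) * deriv g ω) < 0) ∧
    (∀ L : ℝ,
      Tendsto (fun x : ℝ => ∫ ω in Set.Ioi (0 : ℝ), ω / (x ^ 2 + ω ^ 2) * deriv g ω)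
        (nhdsWithin 0 (Set.Ioi 0)) (nhds L) →
      0 < -(2 / (Real.pi * g 0)) * L) := by
  have hdiff : Differentiable ℝ g := hg.differentiable one_ne_zero
  have hcont : Continuous (deriv g) := hg.continuous_deriv le_rfl
  have hanti : AntitoneOn g (Set.Ici 0) :=
    antitoneOn_of_deriv_nonpos (convex_Ici 0) hdiff.continuous.continuousOn
      hdiff.differentiableOn fun x hx => by
        rw [interior_Ici] at hx
        exact hder x (le_of_lt hx)
  obtain ⟨l, hl⟩ := exists_tendsto_atTop_of_antitoneOn_of_nonneg hanti hnonneg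
  have hint : IntegrableOn (deriv g) (Set.Ioi 0) :=
    integrableOn_Ioi_deriv_of_nonpos' (fun x _ => (hdiff x).hasDerivAt)
      (fun x hx => hder x (le_of_lt hx)) hl
  have hker : ∀ x : ℝ, 0 < x → Continuous fun ω : ℝ => ω / (x ^ 2 + ω ^ 2) := fun x hx =>
    continuous_id.div (by fun_prop) fun ω => by positivity
  have hI : ∀ x : ℝ, 0 < x →
      IntegrableOn (fun ω => ω / (x ^ 2 + ω ^ 2) * deriv g ω) (Set.Ioi 0) := by
    intro x hx
    refine hint.bdd_mul (c := 1 / x) (hker x hx).aestronglyMeasurable (.of_forall fun ω => ?_)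
    rw [Real.norm_eq_abs, abs_div, abs_of_pos (by positivity : 0 < x ^ 2 + ω ^ 2),
      div_le_div_iff₀ (by positivity) hx]
    nlinarith [sq_nonneg (|ω| - x), sq_abs ω, abs_nonneg ω]
  have hneg : ∀ x : ℝ, 0 < x →
      (∫ ω in Set.Ioi (0 : ℝ), ω / (x ^ 2 + ω ^ 2) * deriv g ω) < 0 := by
    intro x hx
    have hle : ∀ ω ∈ Set.Ioi (0 : ℝ), ω / (x ^ 2 + ω ^ 2) * deriv g ω ≤ 0 := fun ω hω =>
      mul_nonpos_of_nonneg_of_nonpos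
        (div_nonneg (le_of_lt hω) (by positivity)) (hder ω (le_of_lt hω))
    refine lt_of_le_of_ne (setIntegral_nonpos measurableSet_Ioi hle) fun h0 => ?_
    have hae : (fun ω => -(ω / (x ^ 2 + ω ^ 2) * deriv g ω))
        =ᵐ[volume.restrict (Set.Ioi 0)] fun _ => (0 : ℝ) := by
      refine (setIntegral_eq_zero_iff_of_nonneg_ae ?_ (hI x hx).neg).1 ?_
      · filter_upwards [ae_restrict_mem measurableSet_Ioi] with ω hω
        exact neg_nonneg.2 (hle ω hω)
      · simpa [integral_neg] using h0
    have heq := Measure.eqOn_open_of_ae_eq hae isOpen_Ioi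
      ((hker x hx).mul hcont).neg.continuousOn continuousOn_const
    refine not_forall_deriv_eq_zero_of_integral_eq_one hg hprob heven fun ω hω => ?_
    have hprod := neg_eq_zero.1 (heq (Set.mem_Ioi.2 hω))
    exact (mul_eq_zero.1 hprod).resolve_left (by positivity)
  refine ⟨hneg, fun L hL => ?_⟩
  have hL0 : L < 0 := by
    refine (le_of_tendsto hL ?_).trans_lt (hneg 1 one_pos)
    filter_upwards [Ioc_mem_nhdsGT (zero_lt_one' ℝ)] with x hx
    refine setIntegral_mono_on (hI x hx.1) (hI 1 one_pos) measurableSet_Ioi fun ω hω => ?_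
    have hω' : 0 < ω := hω
    have hx0 := hx.1
    refine mul_le_mul_of_nonpos_right ?_ (hder ω hω'.le)
    have hx1 := hx.2
    gcongr
  have hg0 : 0 < g 0 := by
    refine lt_of_le_of_ne (hnonneg 0) fun h0 => ?_
    refine not_forall_deriv_eq_zero_of_integral_eq_one hg hprob heven fun ω hω => ?_
    have hloc : IsLocalMin g ω := by
      refine .of_forall fun y => ?_
      exact (hanti Set.self_mem_Ici hω.le hω.le).trans (h0 ▸ hnonneg y)
    exact hloc.deriv_eq_zero
  exact mul_pos_of_neg_of_neg (neg_neg_of_pos (by positivity)) hL0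
end
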